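/- arXiv:2011.04255 — 3 statements merged into one kernel-verified Lean document; each statement's English description precedes it below -/
import Mathlib

section
/- Let T be a near-triangulation with boundary cycle C = (u_1, ..., u_h, u_1) and let u_i be a boundary vertex. If there exists an interior vertex v_i adjacent to u_i such that the graph T − {u_i, v_i}, obtained by deleting u_i and v_i and their incident edges, is isomorphic to H_1 or H_2, then T has a total dominating set of size 5 containing u_i. -/
/-!
Common definitions.

A *plane graph* is a finite graph whose vertices are points of the plane `ℝ × ℝ` and whose
edges are drawn as straight-line segments between their endpoints (by Fáry's theorem every
planar graph admits such a drawing).  A *near-triangulation* is a plane graph that is properly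
embedded, biconnected, and all of whose bounded faces are triangles (the faces are the
connected components of the complement of the drawing).  The boundary cycle lists, cyclically,
the vertices on the outer (unbounded) face.
-/

open scoped Classical

noncomputable section

/-- A finite graph drawn in the plane: the vertices are points of `ℝ × ℝ` and each edge is
drawn as the straight-line segment between its endpoints. -/
structure PlaneGraph where
  verts : Finset (ℝ × ℝ)
  Adj : ℝ × ℝ → ℝ × ℝ → Prop
  symm : ∀ p q, Adj p q → Adj q p
  loopless : ∀ p, ¬ Adj p p
  mem_of_adj : ∀ p q, Adj p q → p ∈ verts ∧ q ∈ verts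

namespace PlaneGraph

variable (G : PlaneGraph)

/-- The union of the (closed) segments realizing the edges of the graph. -/
def drawing : Set (ℝ × ℝ) := {x | ∃ p q, G.Adj p q ∧ x ∈ segment ℝ p q}

/-- The straight-line drawing is a proper plane embedding: two edges meet only in common
endpoints and no vertex lies on an edge of which it is not an endpoint. -/
def IsEmbedded : Prop :=
  (∀ p q r s, G.Adj p q → G.Adj r s → ∀ x, x ∈ segment ℝ p q → x ∈ segment ℝ r s →
      ({p, q} : Set (ℝ × ℝ)) = {r, s} ∨
        (x ∈ ({p, q} : Set (ℝ × ℝ)) ∧ x ∈ ({r, s} : Set (ℝ × ℝ)))) ∧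
  (∀ p q v, G.Adj p q → v ∈ G.verts → v ∈ segment ℝ p q → v = p ∨ v = q)

/-- Reachability by walks in the graph. -/
def Reachable (p q : ℝ × ℝ) : Prop := Relation.ReflTransGen G.Adj p q

/-- The graph is connected. -/
def Connected : Prop := G.verts.Nonempty ∧ ∀ p ∈ G.verts, ∀ q ∈ G.verts, G.Reachable p q

/-- Deletion of a set of vertices together with all incident edges. -/
def deleteVerts (S : Finset (ℝ × ℝ)) : PlaneGraph where
  verts := G.verts \ S
  Adj := fun p q => G.Adj p q ∧ p ∉ S ∧ q ∉ S
  symm := fun p q h => ⟨G.symm p q h.1, h.2.2, h.2.1⟩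
  loopless := fun p h => G.loopless p h.1
  mem_of_adj := fun p q h => by
    obtain ⟨h1, h2⟩ := G.mem_of_adj p q h.1
    exact ⟨Finset.mem_sdiff.mpr ⟨h1, h.2.1⟩, Finset.mem_sdiff.mpr ⟨h2, h.2.2⟩⟩

/-- Deletion of a single edge (keeping all vertices). -/
def deleteEdge (p q : ℝ × ℝ) : PlaneGraph where
  verts := G.verts
  Adj := fun a b => G.Adj a b ∧ ¬ ((a = p ∧ b = q) ∨ (a = q ∧ b = p))
  symm := fun a b h => ⟨G.symm a b h.1, by tauto⟩
  loopless := fun a h => G.loopless a h.1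
  mem_of_adj := fun a b h => G.mem_of_adj a b h.1

/-- The (abstract, simple) graph obtained by contracting the edge `(p, q)`:
the vertex `q` is merged into `p`, which becomes the new contracted vertex. -/
def contractEdge (p q : ℝ × ℝ) : PlaneGraph where
  verts := G.verts.erase q
  Adj := fun a b =>
    a ≠ b ∧ a ∈ G.verts.erase q ∧ b ∈ G.verts.erase q ∧
      (G.Adj a b ∨ (a = p ∧ G.Adj q b) ∨ (b = p ∧ G.Adj q a))
  symm := fun a b h => by
    obtain ⟨h1, h2, h3, h4⟩ := h
    refine ⟨h1.symm, h3, h2, ?_⟩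
    rcases h4 with h4 | h4 | h4
    · exact Or.inl (G.symm _ _ h4)
    · exact Or.inr (Or.inr h4)
    · exact Or.inr (Or.inl h4)
  loopless := fun a h => h.1 rfl
  mem_of_adj := fun a b h => ⟨h.2.1, h.2.2.1⟩

/-- Biconnectivity: at least three vertices, connected, and deleting any single vertex leaves
a connected graph. -/
def Biconnected : Prop :=
  3 ≤ G.verts.card ∧ G.Connected ∧ ∀ v ∈ G.verts, (G.deleteVerts {v}).Connected

/-- A face of the plane graph: a connected component of the complement of the drawing. -/
def IsFace (F : Set (ℝ × ℝ)) : Prop :=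
  ∃ x, x ∉ G.drawing ∧ F = connectedComponentIn G.drawingᶜ x

/-- The open triangle with the three given corners. -/
def openTriangle (a b c : ℝ × ℝ) : Set (ℝ × ℝ) :=
  interior (convexHull ℝ ({a, b, c} : Set (ℝ × ℝ)))

/-- Every bounded (inner) face of the drawing is a triangular face of the graph. -/
def InnerFacesTriangles : Prop :=
  ∀ F, G.IsFace F → Bornology.IsBounded F →
    ∃ a ∈ G.verts, ∃ b ∈ G.verts, ∃ c ∈ G.verts,
      G.Adj a b ∧ G.Adj b c ∧ G.Adj a c ∧ F = openTriangle a b c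

/-- A near-triangulation: a properly embedded biconnected plane graph all of whose faces are
triangles, except possibly the outer (unbounded) face. -/
def IsNearTriangulation : Prop :=
  G.IsEmbedded ∧ G.Biconnected ∧ G.InnerFacesTriangles

/-- The outer region: the union of the unbounded components of the complement of the
drawing (for a near-triangulation this is the outer face). -/
def outerRegion : Set (ℝ × ℝ) :=
  {x | x ∉ G.drawing ∧ ¬ Bornology.IsBounded (connectedComponentIn G.drawingᶜ x)}

/-- `u : ZMod h → ℝ × ℝ` is the boundary cycle of `G`: an injective cyclic sequence
`u 0, u 1, …, u (h-1)` of vertices, consecutive ones adjacent, whose edges bound the outer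
face and which contains every vertex lying on the boundary of the outer face. -/
def IsBoundaryCycle {h : ℕ} (u : ZMod h → ℝ × ℝ) : Prop :=
  3 ≤ h ∧ Function.Injective u ∧
  (∀ i, u i ∈ G.verts) ∧
  (∀ i, G.Adj (u i) (u (i + 1))) ∧
  (∀ i, segment ℝ (u i) (u (i + 1)) ⊆ frontier G.outerRegion) ∧
  (∀ v ∈ G.verts, (v : ℝ × ℝ) ∈ frontier G.outerRegion → v ∈ Set.range u)

/-- An interior vertex: a vertex not on the boundary cycle. -/
def IsInteriorVtx {h : ℕ} (u : ZMod h → ℝ × ℝ) (v : ℝ × ℝ) : Prop :=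
  v ∈ G.verts ∧ v ∉ Set.range u

/-- The edge `(p, q)` is a diagonal: it joins two non-consecutive boundary vertices. -/
def IsDiagonalEdge {h : ℕ} (u : ZMod h → ℝ × ℝ) (p q : ℝ × ℝ) : Prop :=
  G.Adj p q ∧ ∃ i j : ZMod h, p = u i ∧ q = u j ∧ j ≠ i + 1 ∧ i ≠ j + 1

/-- The graph has no diagonals: any edge between boundary vertices joins consecutive ones. -/
def HasNoDiagonals {h : ℕ} (u : ZMod h → ℝ × ℝ) : Prop :=
  ∀ i j : ZMod h, G.Adj (u i) (u j) → j = i + 1 ∨ i = j + 1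

/-- The degree of a vertex. -/
def degree (v : ℝ × ℝ) : ℕ := (G.verts.filter (fun w => G.Adj v w)).card

/-- The degree of a vertex in the subgraph induced on the set `S` of vertices. -/
def degreeOn (S : Set (ℝ × ℝ)) (v : ℝ × ℝ) : ℕ :=
  (G.verts.filter (fun w => G.Adj v w ∧ w ∈ S)).card

/-- A total dominating set: every vertex of the graph is adjacent to a member of `D`. -/
def IsTDS (D : Finset (ℝ × ℝ)) : Prop :=
  D ⊆ G.verts ∧ ∀ v ∈ G.verts, ∃ d ∈ D, G.Adj v d

/-- The total domination number `γₜ`. -/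
def totalDominationNumber : ℕ :=
  sInf {k | ∃ D : Finset (ℝ × ℝ), G.IsTDS D ∧ D.card = k}

/-- Isomorphism of plane graphs as abstract graphs. -/
def IsIsoTo (H : PlaneGraph) : Prop :=
  ∃ f : ℝ × ℝ → ℝ × ℝ,
    Set.BijOn f (↑G.verts) (↑H.verts) ∧
    ∀ p ∈ G.verts, ∀ q ∈ G.verts, (G.Adj p q ↔ H.Adj (f p) (f q))

/-- The edge `(p, q)` is contractible: the contracted graph `G/e` is (abstractly isomorphic
to) a near-triangulation. -/
def IsContractible (p q : ℝ × ℝ) : Prop :=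
  G.Adj p q ∧ ∃ H : PlaneGraph, H.IsNearTriangulation ∧ (G.contractEdge p q).IsIsoTo H

/-- A separating triangle: a triangle of the graph with some vertex strictly inside it and
some vertex outside it. -/
def IsSeparatingTriangle (a b c : ℝ × ℝ) : Prop :=
  a ∈ G.verts ∧ b ∈ G.verts ∧ c ∈ G.verts ∧
  G.Adj a b ∧ G.Adj b c ∧ G.Adj a c ∧
  (∃ v ∈ G.verts, v ∈ openTriangle a b c) ∧
  (∃ v ∈ G.verts, v ∉ convexHull ℝ ({a, b, c} : Set (ℝ × ℝ)))

/-- Edge list of the first exceptional 12-vertex maximal outerplanar graph `H₁`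
(boundary 12-cycle, central triangle `{0,4,8}`, ear triangles `{1,2,3}`, `{5,6,7}`,
`{9,10,11}`, and the three remaining quadrilateral diagonals, all with the same
orientation). -/
def exc1Edges : List (Fin 12 × Fin 12) :=
  [(0,1),(1,2),(2,3),(3,4),(4,5),(5,6),(6,7),(7,8),(8,9),(9,10),(10,11),(11,0),
   (0,4),(4,8),(0,8),(1,3),(5,7),(9,11),(0,3),(4,7),(8,11)]

/-- Edge list of the second exceptional 12-vertex maximal outerplanar graph `H₂`
(same as `H₁` except that one quadrilateral diagonal has the opposite orientation). -/
def exc2Edges : List (Fin 12 × Fin 12) :=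
  [(0,1),(1,2),(2,3),(3,4),(4,5),(5,6),(6,7),(7,8),(8,9),(9,10),(10,11),(11,0),
   (0,4),(4,8),(0,8),(1,3),(5,7),(9,11),(0,3),(4,7),(0,9)]

/-- The exceptional graph `H₁`. -/
def H1graph : SimpleGraph (Fin 12) := SimpleGraph.fromRel (fun a b => (a, b) ∈ exc1Edges)

/-- The exceptional graph `H₂`. -/
def H2graph : SimpleGraph (Fin 12) := SimpleGraph.fromRel (fun a b => (a, b) ∈ exc2Edges)

/-- Isomorphism between a plane graph and a simple graph on `Fin 12`. -/
def IsIsoToSG (H : SimpleGraph (Fin 12)) : Prop :=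
  ∃ f : ℝ × ℝ → Fin 12,
    Set.BijOn f (↑G.verts) Set.univ ∧
    ∀ p ∈ G.verts, ∀ q ∈ G.verts, (G.Adj p q ↔ H.Adj (f p) (f q))

/-- `G` is isomorphic to `H₁` or to `H₂`. -/
def IsExceptional : Prop := G.IsIsoToSG H1graph ∨ G.IsIsoToSG H2graph

/-- A maximal outerplanar graph (MOP): a near-triangulation all of whose vertices lie on the
boundary cycle. -/
def IsMOP : Prop :=
  G.IsNearTriangulation ∧
    ∃ (h : ℕ) (u : ZMod h → ℝ × ℝ), G.IsBoundaryCycle u ∧ ∀ v ∈ G.verts, v ∈ Set.range u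

/-- The graph is Hamiltonian: it has a cycle through all of its vertices. -/
def IsHamiltonian : Prop :=
  ∃ (m : ℕ) (c : ZMod m → ℝ × ℝ), 3 ≤ m ∧ Function.Injective c ∧
    (∀ i, G.Adj (c i) (c (i + 1))) ∧ ∀ v ∈ G.verts, v ∈ Set.range c

/-- An outerplane graph: a properly embedded plane graph all of whose vertices lie on the
boundary of the outer region. -/
def IsOuterplane : Prop :=
  G.IsEmbedded ∧ ∀ v ∈ G.verts, (v : ℝ × ℝ) ∈ closure G.outerRegion

/-- The union of the boundary-cycle segments. -/
def boundaryDrawing {h : ℕ} (u : ZMod h → ℝ × ℝ) : Set (ℝ × ℝ) :=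
  ⋃ i : ZMod h, segment ℝ (u i) (u (i + 1))

/-- The open interior of the boundary cycle, viewed as a simple closed polygon. -/
def polygonInterior {h : ℕ} (u : ZMod h → ℝ × ℝ) : Set (ℝ × ℝ) :=
  {x | x ∉ boundaryDrawing u ∧
    Bornology.IsBounded (connectedComponentIn (boundaryDrawing u)ᶜ x)}

/-- The union of the segments realizing the diagonals of `G[C]`. -/
def diagonalDrawing {h : ℕ} (u : ZMod h → ℝ × ℝ) : Set (ℝ × ℝ) :=
  {x | ∃ i j : ZMod h, G.Adj (u i) (u j) ∧ j ≠ i + 1 ∧ i ≠ j + 1 ∧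
    x ∈ segment ℝ (u i) (u j)}

/-- A region of the subdivision of the interior of the boundary cycle by the diagonals of
`G[C]`: a connected component of the interior of the cycle minus the diagonals. -/
def IsSubdivisionRegion {h : ℕ} (u : ZMod h → ℝ × ℝ) (R : Set (ℝ × ℝ)) : Prop :=
  ∃ x ∈ polygonInterior u \ G.diagonalDrawing u,
    R = connectedComponentIn (polygonInterior u \ G.diagonalDrawing u) x

/-- The diagonal `(u i, u j)` is a side of the region `R`. -/
def IsSideOf {h : ℕ} (u : ZMod h → ℝ × ℝ) (R : Set (ℝ × ℝ)) (i j : ZMod h) : Prop :=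
  G.Adj (u i) (u j) ∧ j ≠ i + 1 ∧ i ≠ j + 1 ∧
    segment ℝ (u i) (u j) \ {u i, u j} ⊆ frontier R

/-- `v` lies on the opposite side of the diagonal `(u i, u j)` from the region `R`:
inside the boundary polygon, `v` cannot be joined to `R` without crossing the diagonal. -/
def OppositeSideOf {h : ℕ} (u : ZMod h → ℝ × ℝ) (R : Set (ℝ × ℝ)) (i j : ZMod h)
    (v : ℝ × ℝ) : Prop :=
  ∀ x ∈ R, v ∉ connectedComponentIn (polygonInterior u \ segment ℝ (u i) (u j)) x

/-- A terminal polygon: a region of the subdivision containing some interior vertex such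
that at most one of its sides has interior vertices of `G` on its opposite side
(i.e. at most one of the outer parts `T_out(P,d)` contains interior vertices). -/
def IsTerminalPolygon {h : ℕ} (u : ZMod h → ℝ × ℝ) (R : Set (ℝ × ℝ)) : Prop :=
  G.IsSubdivisionRegion u R ∧
  (∃ v, G.IsInteriorVtx u v ∧ v ∈ R) ∧
  ∀ i j k l : ZMod h,
    G.IsSideOf u R i j → G.IsSideOf u R k l →
    (∃ w, G.IsInteriorVtx u w ∧ OppositeSideOf u R i j w) →
    (∃ w, G.IsInteriorVtx u w ∧ OppositeSideOf u R k l w) →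
    ({u i, u j} : Set (ℝ × ℝ)) = {u k, u l}

/-- An irreducible near-triangulation: it has interior vertices, and for every boundary edge
`(u i, u (i+1))` the third vertex of the inner triangular face containing this edge also lies
on the boundary cycle. -/
def Irreducible {h : ℕ} (u : ZMod h → ℝ × ℝ) : Prop :=
  (∃ v, G.IsInteriorVtx u v) ∧
  ∀ i : ZMod h, ∀ v ∈ G.verts,
    G.Adj (u i) v → G.Adj (u (i + 1)) v →
    G.IsFace (openTriangle (u i) (u (i + 1)) v) → v ∈ Set.range u

end PlaneGraph

namespace PlaneGraph

/-- Twice the signed area of the triangle `p q r`. -/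
def cross (p q r : ℝ × ℝ) : ℝ :=
  (q.1 - p.1) * (r.2 - p.2) - (q.2 - p.2) * (r.1 - p.1)

lemma continuous_cross_right (p q : ℝ × ℝ) : Continuous (cross p q) := by
  unfold cross; fun_prop

lemma cross_combo (p q a b : ℝ × ℝ) (s t : ℝ) (hst : s + t = 1) :
    cross p q (s • a + t • b) = s * cross p q a + t * cross p q b := by
  obtain rfl : s = 1 - t := by linarith
  simp only [cross, Prod.fst_add, Prod.snd_add, Prod.smul_fst, Prod.smul_snd, smul_eq_mul]
  ring

lemma cross_add_cross_add_cross (p q r x : ℝ × ℝ) :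
    cross q r x + cross r p x + cross p q x = cross p q r := by
  simp only [cross]; ring

lemma smul_cross_combo (p q r x : ℝ × ℝ) :
    cross p q r • x = cross q r x • p + cross r p x • q + cross p q x • r := by
  ext <;> simp [cross] <;> ring

lemma mem_segment_of_combo {a b x : ℝ × ℝ} {s t c : ℝ} (hs : 0 ≤ s) (ht : 0 ≤ t)
    (hst : s + t = c) (hc : 0 < c) (h : c • x = s • a + t • b) : x ∈ segment ℝ a b := by
  refine ⟨s / c, t / c, by positivity, by positivity, by field_simp; linarith, ?_⟩
  have : x = c⁻¹ • (c • x) := by rw [smul_smul, inv_mul_cancel₀ hc.ne', one_smul]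
  rw [this, h, smul_add, smul_smul, smul_smul, div_eq_inv_mul, div_eq_inv_mul]

lemma mem_convexHull_of_combo {p q r x : ℝ × ℝ} {s t w c : ℝ} (hs : 0 ≤ s) (ht : 0 ≤ t)
    (hw : 0 ≤ w) (hc : 0 < c) (hsum : s + t + w = c)
    (h : c • x = s • p + t • q + w • r) : x ∈ convexHull ℝ ({p, q, r} : Set (ℝ × ℝ)) := by
  have hx : x = (s / c) • p + (t / c) • q + (w / c) • r := by
    have : x = c⁻¹ • (c • x) := by rw [smul_smul, inv_mul_cancel₀ hc.ne', one_smul]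
    rw [this, h, smul_add, smul_add, smul_smul, smul_smul, smul_smul]
    simp only [div_eq_inv_mul]
  have hsub := subset_convexHull ℝ ({p, q, r} : Set (ℝ × ℝ))
  rw [hx]
  have h1 : s / c + t / c + w / c = 1 := by field_simp; linarith
  have := (convex_convexHull ℝ ({p, q, r} : Set (ℝ × ℝ))).sum_mem
    (t := (Finset.univ : Finset (Fin 3))) (w := ![s / c, t / c, w / c]) (z := ![p, q, r])
    (by intro i _; fin_cases i <;> simp <;> positivity)
    (by simpa [Fin.sum_univ_three] using h1)
    (by intro i _; fin_cases i <;> simp <;> apply hsub <;> simp)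
  simpa [Fin.sum_univ_three, add_assoc] using this

lemma convexHull_triangle_comm (p q r : ℝ × ℝ) :
    convexHull ℝ ({p, q, r} : Set (ℝ × ℝ)) = convexHull ℝ {q, p, r} := by
  rw [Set.insert_comm]

lemma openTriangle_swap (p q r : ℝ × ℝ) : openTriangle p q r = openTriangle q p r := by
  rw [openTriangle, openTriangle, convexHull_triangle_comm]

lemma openTriangle_swap_right (p q r : ℝ × ℝ) : openTriangle p q r = openTriangle p r q := by
  rw [openTriangle, openTriangle, Set.pair_comm]

lemma isOpen_openTriangle (p q r : ℝ × ℝ) : IsOpen (openTriangle p q r) := isOpen_interior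

lemma convex_openTriangle (p q r : ℝ × ℝ) : Convex ℝ (openTriangle p q r) :=
  (convex_convexHull ℝ _).interior

lemma openTriangle_subset (p q r : ℝ × ℝ) :
    openTriangle p q r ⊆ convexHull ℝ ({p, q, r} : Set (ℝ × ℝ)) := interior_subset

lemma isCompact_triangle (p q r : ℝ × ℝ) :
    IsCompact (convexHull ℝ ({p, q, r} : Set (ℝ × ℝ))) :=
  (Set.toFinite _).isCompact_convexHull ℝ

lemma isBounded_openTriangle (p q r : ℝ × ℝ) : Bornology.IsBounded (openTriangle p q r) :=
  (isCompact_triangle p q r).isBounded.subset (openTriangle_subset p q r)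

lemma triangle_subset_of_pos {p q r : ℝ × ℝ} (hD : 0 < cross p q r) :
    convexHull ℝ ({p, q, r} : Set (ℝ × ℝ)) ⊆
      openTriangle p q r ∪ (segment ℝ p q ∪ segment ℝ q r ∪ segment ℝ r p) := by
  have hge : convexHull ℝ ({p, q, r} : Set (ℝ × ℝ)) ⊆
      {x | 0 ≤ cross q r x ∧ 0 ≤ cross r p x ∧ 0 ≤ cross p q x} := by
    refine convexHull_min ?_ ?_
    · have h1 : cross q r p = cross p q r := by simp only [cross]; ring
      have h2 : cross r p q = cross p q r := by simp only [cross]; ring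
      have h0 : ∀ a b : ℝ × ℝ, cross a b a = 0 ∧ cross a b b = 0 := fun a b => by
        simp only [cross]; constructor <;> ring
      rintro x (rfl | rfl | rfl) <;> simp [h0, h1, h2, hD.le]
    · rintro a ⟨a1, a2, a3⟩ b ⟨b1, b2, b3⟩ s t hs ht hst
      simp only [Set.mem_ofPred_eq, cross_combo _ _ _ _ _ _ hst]
      exact ⟨by positivity, by positivity, by positivity⟩
  intro x hx
  obtain ⟨h1, h2, h3⟩ := hge hx
  have hsum := cross_add_cross_add_cross p q r x
  have hcomb := smul_cross_combo p q r x
  rcases h1.eq_or_lt with h1' | h1'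
  · refine Or.inr (Or.inl (Or.inr (mem_segment_of_combo h2 h3 (by linarith) hD ?_)))
    rw [hcomb, ← h1', zero_smul, zero_add]
  rcases h2.eq_or_lt with h2' | h2'
  · refine Or.inr (Or.inr (mem_segment_of_combo h3 h1 (by linarith) hD ?_))
    rw [hcomb, ← h2', zero_smul, add_zero, add_comm]
  rcases h3.eq_or_lt with h3' | h3'
  · refine Or.inr (Or.inl (Or.inl (mem_segment_of_combo h1 h2 (by linarith) hD ?_)))
    rw [hcomb, ← h3', zero_smul, add_zero]
  left
  refine mem_interior.mpr ⟨{y | 0 < cross q r y ∧ 0 < cross r p y ∧ 0 < cross p q y}, ?_, ?_,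
    h1', h2', h3'⟩
  · rintro y ⟨y1, y2, y3⟩
    exact mem_convexHull_of_combo y1.le y2.le y3.le hD (cross_add_cross_add_cross p q r y)
      (smul_cross_combo p q r y)
  · exact (isOpen_lt continuous_const (continuous_cross_right _ _)).inter
      ((isOpen_lt continuous_const (continuous_cross_right _ _)).inter
        (isOpen_lt continuous_const (continuous_cross_right _ _)))

lemma triangle_subset {p q r : ℝ × ℝ} (hD : cross p q r ≠ 0) :
    convexHull ℝ ({p, q, r} : Set (ℝ × ℝ)) ⊆
      openTriangle p q r ∪ (segment ℝ p q ∪ segment ℝ q r ∪ segment ℝ r p) := by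
  rcases hD.lt_or_gt with h | h
  · have h' : 0 < cross q p r := by
      have : cross q p r = - cross p q r := by simp only [cross]; ring
      linarith
    have := triangle_subset_of_pos h'
    rw [openTriangle_swap p q r, convexHull_triangle_comm p q r, segment_symm ℝ p q,
      segment_symm ℝ q r, segment_symm ℝ r p]
    refine this.trans (Set.union_subset_union_right _ ?_)
    rintro x ((h | h) | h)
    · exact Or.inl (Or.inl h)
    · exact Or.inr h
    · exact Or.inl (Or.inr h)
  · exact triangle_subset_of_pos h

lemma mem_segment_of_cross_eq_zero {p q r : ℝ × ℝ} (hpq : p ≠ q) (h : cross p q r = 0) :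
    r ∈ segment ℝ p q ∨ q ∈ segment ℝ p r ∨ p ∈ segment ℝ r q := by
  have hcol : Collinear ℝ ({p, q, r} : Set (ℝ × ℝ)) := by
    rw [collinear_iff_of_mem (p₀ := p) (by simp)]
    refine ⟨q - p, ?_⟩
    have hq : q.1 - p.1 ≠ 0 ∨ q.2 - p.2 ≠ 0 := by
      by_contra! hc
      exact hpq (Prod.ext (by linarith [hc.1]) (by linarith [hc.2]))
    simp only [cross] at h
    rintro x (rfl | rfl | rfl)
    · exact ⟨0, by simp⟩
    · exact ⟨1, by simp⟩
    · rcases hq with hq | hq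
      · refine ⟨(x.1 - p.1) / (q.1 - p.1), Prod.ext ?_ ?_⟩ <;> simp <;> field_simp <;> linarith
      · refine ⟨(x.2 - p.2) / (q.2 - p.2), Prod.ext ?_ ?_⟩ <;> simp <;> field_simp <;> linarith
  rcases hcol.wbtw_or_wbtw_or_wbtw with h | h | h
  · exact Or.inr (Or.inl (mem_segment_iff_wbtw.mpr h))
  · left; rw [segment_symm]; exact mem_segment_iff_wbtw.mpr h
  · exact Or.inr (Or.inr (mem_segment_iff_wbtw.mpr h))

/-- A preconnected set avoiding the sides of a nondegenerate triangle and meeting its interior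
lies inside it. -/
lemma subset_openTriangle_of_isPreconnected {p q r : ℝ × ℝ} (hD : cross p q r ≠ 0)
    {S : Set (ℝ × ℝ)} (hS : IsPreconnected S)
    (hdisj : ∀ x ∈ S, x ∉ segment ℝ p q ∧ x ∉ segment ℝ q r ∧ x ∉ segment ℝ r p)
    (hne : (S ∩ openTriangle p q r).Nonempty) : S ⊆ openTriangle p q r := by
  refine hS.subset_left_of_subset_union (isOpen_openTriangle p q r)
    (isCompact_triangle p q r).isClosed.isOpen_compl
    (Set.disjoint_compl_right_iff_subset.mpr (openTriangle_subset p q r)) ?_ hne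
  intro x hx
  by_cases h : x ∈ convexHull ℝ ({p, q, r} : Set (ℝ × ℝ))
  · rcases triangle_subset hD h with h | (h | h) | h
    · exact Or.inl h
    · exact absurd h (hdisj x hx).1
    · exact absurd h (hdisj x hx).2.1
    · exact absurd h (hdisj x hx).2.2
  · exact Or.inr h

variable {G : PlaneGraph}

lemma Adj.ne {p q : ℝ × ℝ} (h : G.Adj p q) : p ≠ q := by
  rintro rfl; exact G.loopless _ h

/-- Three pairwise adjacent vertices. -/
structure IsTriangle (G : PlaneGraph) (p q r : ℝ × ℝ) : Prop where
  adj₁₂ : G.Adj p q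
  adj₂₃ : G.Adj q r
  adj₁₃ : G.Adj p r

lemma IsEmbedded.disjoint (hE : G.IsEmbedded) {p q r s x : ℝ × ℝ} (hpq : G.Adj p q)
    (hrs : G.Adj r s) (hpr : p ≠ r) (hps : p ≠ s) (hqr : q ≠ r) (hqs : q ≠ s)
    (hx : x ∈ segment ℝ p q) : x ∉ segment ℝ r s := by
  intro hx'
  rcases hE.1 p q r s hpq hrs x hx hx' with h | ⟨rfl | rfl, h | h⟩
  · have : p ∈ ({r, s} : Set (ℝ × ℝ)) := h ▸ Set.mem_insert p _
    rcases this with h | h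
    exacts [hpr h, hps h]
  exacts [hpr h, hps h, hqr h, hqs h]

lemma IsTriangle.cross_ne_zero {p q r : ℝ × ℝ} (ht : G.IsTriangle p q r)
    (hE : G.IsEmbedded) : cross p q r ≠ 0 := by
  intro h0
  have hv := hE.2
  have h12 := ht.adj₁₂; have h23 := ht.adj₂₃; have h13 := ht.adj₁₃
  rcases mem_segment_of_cross_eq_zero h12.ne h0 with h | h | h
  · rcases hv _ _ _ h12 (G.mem_of_adj _ _ h13).2 h with h | h
    exacts [h13.ne h.symm, h23.ne h.symm]
  · rcases hv _ _ _ h13 (G.mem_of_adj _ _ h12).2 h with h | h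
    exacts [h12.ne h.symm, h23.ne h]
  · rcases hv _ _ _ (G.symm _ _ h23) (G.mem_of_adj _ _ h12).1 h with h | h
    exacts [h13.ne h, h12.ne h]

lemma segment_subset_drawing {p q : ℝ × ℝ} (h : G.Adj p q) : segment ℝ p q ⊆ G.drawing :=
  fun _ hx => ⟨p, q, h, hx⟩

lemma isClosed_drawing (G : PlaneGraph) : IsClosed G.drawing := by
  have : G.drawing = ⋃ e ∈ {e : (ℝ × ℝ) × (ℝ × ℝ) | G.Adj e.1 e.2}, segment ℝ e.1 e.2 := by
    ext x; simp [drawing]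
  rw [this]
  refine Set.Finite.isClosed_biUnion ?_ fun e _ => ?_
  · refine (G.verts ×ˢ G.verts).finite_toSet.subset fun e he => ?_
    have := G.mem_of_adj _ _ he
    simpa using this
  · rw [← convexHull_pair]
    exact ((Set.toFinite _).isCompact_convexHull ℝ).isClosed

lemma IsTriangle.component_subset {p q r x : ℝ × ℝ} (ht : G.IsTriangle p q r)
    (hE : G.IsEmbedded) (hx : x ∈ openTriangle p q r) (hxd : x ∉ G.drawing) :
    connectedComponentIn G.drawingᶜ x ⊆ openTriangle p q r := by
  refine subset_openTriangle_of_isPreconnected (ht.cross_ne_zero hE)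
    isPreconnected_connectedComponentIn (fun y hy => ?_) ⟨x, mem_connectedComponentIn hxd, hx⟩
  have hy' : y ∉ G.drawing := connectedComponentIn_subset _ _ hy
  exact ⟨fun h => hy' (segment_subset_drawing ht.adj₁₂ h),
    fun h => hy' (segment_subset_drawing ht.adj₂₃ h),
    fun h => hy' (segment_subset_drawing (G.symm _ _ ht.adj₁₃) h)⟩

/-- A vertex on the boundary of the outer face is inside no triangle. -/
lemma IsTriangle.not_mem_of_mem_frontier {p q r x : ℝ × ℝ} (ht : G.IsTriangle p q r)
    (hE : G.IsEmbedded) (hx : x ∈ frontier G.outerRegion) : x ∉ openTriangle p q r := by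
  intro hxo
  obtain ⟨y, hyo, hyd, hyb⟩ :=
    mem_closure_iff.mp (frontier_subset_closure hx) _ (isOpen_openTriangle p q r) hxo
  exact hyb ((isBounded_openTriangle p q r).subset (ht.component_subset hE hyo hyd))

/-- An edge with an end inside a triangle stays inside the triangle unless it ends in one of
its corners. -/
lemma IsTriangle.mem_of_adj {p q r x y : ℝ × ℝ} (ht : G.IsTriangle p q r)
    (hE : G.IsEmbedded) (hxy : G.Adj x y) (hx : x ∈ openTriangle p q r)
    (hxp : x ≠ p) (hxq : x ≠ q) (hxr : x ≠ r) (hyp : y ≠ p) (hyq : y ≠ q) (hyr : y ≠ r) :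
    y ∈ openTriangle p q r :=
  subset_openTriangle_of_isPreconnected (ht.cross_ne_zero hE)
    (convex_segment x y).isPreconnected
    (fun _ hz => ⟨hE.disjoint hxy ht.adj₁₂ hxp hxq hyp hyq hz,
      hE.disjoint hxy ht.adj₂₃ hxq hxr hyq hyr hz,
      hE.disjoint hxy (G.symm _ _ ht.adj₁₃) hxr hxp hyr hyp hz⟩)
    ⟨x, left_mem_segment ℝ x y, hx⟩ (right_mem_segment ℝ x y)

/-- Of two triangles on the same side of a common edge, one contains the apex of the other. -/
lemma IsTriangle.nested {p q r s : ℝ × ℝ} (hr : G.IsTriangle p q r) (hs : G.IsTriangle p q s)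
    (hE : G.IsEmbedded) (hrs : r ≠ s) (hside : 0 < cross p q r * cross p q s) :
    r ∈ openTriangle p q s ∨ s ∈ openTriangle p q r := by
  wlog hpos : 0 < cross p q r generalizing p q
  · have hswap : ∀ x, cross q p x = - cross p q x := fun x => by simp only [cross]; ring
    have hr' : G.IsTriangle q p r := ⟨G.symm _ _ hr.adj₁₂, hr.adj₁₃, hr.adj₂₃⟩
    have hs' : G.IsTriangle q p s := ⟨G.symm _ _ hs.adj₁₂, hs.adj₁₃, hs.adj₂₃⟩
    have hlt : cross p q r < 0 := lt_of_le_of_ne (not_lt.mp hpos) (hr.cross_ne_zero hE)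
    rw [openTriangle_swap p q s, openTriangle_swap p q r]
    exact this hr' hs' (by rw [hswap, hswap]; linarith) (by rw [hswap]; linarith)
  have hpos' : 0 < cross p q s := pos_of_mul_pos_right hside hpos.le
  have hpq := hr.adj₁₂.ne; have hpr := hr.adj₁₃.ne; have hqr := hr.adj₂₃.ne
  have hps := hs.adj₁₃.ne; have hqs := hs.adj₂₃.ne
  have mem : ∀ {a b : ℝ × ℝ}, G.IsTriangle p q a → b ∈ G.verts → b ≠ p → b ≠ q → b ≠ a →
      b ∈ convexHull ℝ ({p, q, a} : Set (ℝ × ℝ)) → b ∈ openTriangle p q a := by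
    intro a b ha hb hbp hbq hba hmem
    rcases triangle_subset (ha.cross_ne_zero hE) hmem with h | (h | h) | h
    · exact h
    · exact (hE.2 _ _ _ ha.adj₁₂ hb h).elim (absurd · hbp) (absurd · hbq)
    · exact (hE.2 _ _ _ ha.adj₂₃ hb h).elim (absurd · hbq) (absurd · hba)
    · exact (hE.2 _ _ _ (G.symm _ _ ha.adj₁₃) hb h).elim (absurd · hba) (absurd · hbp)
  have hcomb := smul_cross_combo p q r s
  have hsum := cross_add_cross_add_cross p q r s
  set D := cross p q r
  set α := cross q r s
  set β := cross r p s
  set γ := cross p q s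
  rcases le_or_gt 0 α with hα | hα <;> rcases le_or_gt 0 β with hβ | hβ
  · right
    exact mem hr (G.mem_of_adj _ _ hs.adj₁₃).2 hps.symm hqs.symm hrs.symm
      (mem_convexHull_of_combo hα hβ hpos'.le hpos hsum hcomb)
  · exfalso
    have hc : 0 < D - β := by linarith
    have h1 : (D - β) • ((D / (D - β)) • s + (-β / (D - β)) • q) = D • s + (-β) • q := by
      rw [smul_add, smul_smul, smul_smul, mul_div_cancel₀ _ hc.ne', mul_div_cancel₀ _ hc.ne']
    refine hE.disjoint (G.symm _ _ hs.adj₂₃) hr.adj₁₃ hps.symm hrs.symm hpq.symm hqr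
      (mem_segment_of_combo hpos.le (by linarith) (by ring) hc h1)
      (mem_segment_of_combo hα hpos'.le (by linarith) hc ?_)
    rw [h1, hcomb]; module
  · exfalso
    have hc : 0 < D - α := by linarith
    have h1 : (D - α) • ((D / (D - α)) • s + (-α / (D - α)) • p) = D • s + (-α) • p := by
      rw [smul_add, smul_smul, smul_smul, mul_div_cancel₀ _ hc.ne', mul_div_cancel₀ _ hc.ne']
    refine hE.disjoint (G.symm _ _ hs.adj₁₃) hr.adj₂₃ hqs.symm hrs.symm hpq hpr
      (mem_segment_of_combo hpos.le (by linarith) (by ring) hc h1)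
      (mem_segment_of_combo hβ hpos'.le (by linarith) hc ?_)
    rw [h1, hcomb]; module
  · left
    refine mem hs (G.mem_of_adj _ _ hr.adj₁₃).2 hpr.symm hqr.symm hrs
      (mem_convexHull_of_combo (s := -α) (t := -β) (w := D) (by linarith) (by linarith)
        hpos.le hpos' (by linarith) ?_)
    rw [hcomb]; module

/-- The face next to the midpoint of an edge inside a triangle, on the side given by `d`, is a
triangle containing the edge. -/
lemma exists_face_beside {p q r x y d : ℝ × ℝ} (hE : G.IsEmbedded)
    (hF : G.InnerFacesTriangles) (ht : G.IsTriangle p q r) (hxy : G.Adj x y)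
    (hm : midpoint ℝ x y ∈ openTriangle p q r) (hd : cross x y (x + d) ≠ 0) :
    ∃ z, G.Adj x z ∧ G.Adj y z ∧ midpoint ℝ x y ∉ openTriangle x y z ∧
      ∃ ε > (0 : ℝ), ∀ t ∈ Set.Ioo 0 ε, midpoint ℝ x y + t • d ∈ openTriangle x y z := by
  set m := midpoint ℝ x y with hm_def
  have hmx : m ≠ x := fun h => hxy.ne ((midpoint_eq_left_iff ℝ).mp h)
  have hmy : m ≠ y := fun h => hxy.ne ((midpoint_eq_right_iff ℝ).mp h)
  have hms : m ∈ segment ℝ x y := midpoint_mem_segment x y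
  have hedge : ∀ a b, G.Adj a b → m ∈ segment ℝ a b → (a = x ∧ b = y) ∨ (a = y ∧ b = x) := by
    intro a b hab hmab
    rcases hE.1 a b x y hab hxy m hmab hms with h | ⟨-, h | h⟩
    · rcases Set.pair_eq_pair_iff.mp h with h | h
      exacts [Or.inl h, Or.inr h]
    exacts [absurd h hmx, absurd h hmy]
  have hm' : m ∉ (G.deleteEdge x y).drawing := by
    rintro ⟨a, b, ⟨hab, hne⟩, hmab⟩
    exact hne (hedge a b hab hmab)
  have hU : IsOpen (openTriangle p q r ∩ (G.deleteEdge x y).drawingᶜ) :=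
    (isOpen_openTriangle p q r).inter (isClosed_drawing _).isOpen_compl
  have hcont : Continuous fun t : ℝ => m + t • d := by fun_prop
  obtain ⟨ε, hε, hball⟩ := Metric.isOpen_iff.mp (hU.preimage hcont) 0
    (by simpa using ⟨hm, hm'⟩)
  have hin : ∀ t ∈ Set.Ioo 0 ε, m + t • d ∈ openTriangle p q r ∧ m + t • d ∉ G.drawing := by
    intro t ht'
    have htU := hball (show t ∈ Metric.ball 0 ε by
      rw [Metric.mem_ball, Real.dist_0_eq_abs, abs_of_pos ht'.1]; exact ht'.2)
    refine ⟨htU.1, ?_⟩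
    rintro ⟨a, b, hab, hmem⟩
    by_cases hne : (a = x ∧ b = y) ∨ (a = y ∧ b = x)
    · have hmem' : m + t • d ∈ segment ℝ x y := by
        rcases hne with ⟨rfl, rfl⟩ | ⟨rfl, rfl⟩
        · exact hmem
        · rwa [segment_symm]
      obtain ⟨α, β, -, -, hsum, hab⟩ := hmem'
      have h1 : cross x y (m + t • d) = 0 := by
        rw [← hab, cross_combo _ _ _ _ _ _ hsum]
        simp only [cross]; ring
      have h2 : cross x y (m + t • d) = t * cross x y (x + d) := by
        rw [hm_def, midpoint_eq_smul_add]
        simp only [cross, Prod.fst_add, Prod.snd_add, Prod.smul_fst, Prod.smul_snd, smul_eq_mul,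
          invOf_eq_inv]
        ring
      exact mul_ne_zero ht'.1.ne' hd (h2.symm.trans h1)
    · exact htU.2 ⟨a, b, ⟨hab, hne⟩, hmem⟩
  obtain ⟨h0, h0d⟩ := hin (ε / 2) ⟨by linarith, by linarith⟩
  set F := connectedComponentIn G.drawingᶜ (m + (ε / 2) • d) with hF_def
  have hSF : ∀ t ∈ Set.Ioo 0 ε, m + t • d ∈ F := by
    have : (fun t : ℝ => m + t • d) '' Set.Ioo 0 ε ⊆ F := by
      refine (isPreconnected_Ioo.image _ hcont.continuousOn).subset_connectedComponentIn
        ⟨ε / 2, ⟨by linarith, by linarith⟩, rfl⟩ ?_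
      rintro _ ⟨t, ht', rfl⟩
      exact (hin t ht').2
    exact fun t ht' => this ⟨t, ht', rfl⟩
  obtain ⟨a, -, b, -, c, -, hab, hbc, hac, hFabc⟩ := hF F ⟨_, h0d, rfl⟩
    ((isBounded_openTriangle p q r).subset (ht.component_subset hE h0 h0d))
  have hmF : m ∉ F := fun h =>
    connectedComponentIn_subset _ _ h (segment_subset_drawing hxy hms)
  have key : ∀ a b c, G.Adj a b → G.Adj b c → G.Adj a c → F = openTriangle a b c →
      m ∈ segment ℝ a b → ∃ z, G.Adj x z ∧ G.Adj y z ∧ m ∉ openTriangle x y z ∧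
      ∃ ε > (0 : ℝ), ∀ t ∈ Set.Ioo 0 ε, m + t • d ∈ openTriangle x y z := by
    intro a b c hab hbc hac hFabc hmab
    rcases hedge a b hab hmab with ⟨rfl, rfl⟩ | ⟨rfl, rfl⟩
    · exact ⟨c, hac, hbc, hFabc ▸ hmF, ε, hε, hFabc ▸ hSF⟩
    · rw [openTriangle_swap] at hFabc
      exact ⟨c, hbc, hac, hFabc ▸ hmF, ε, hε, hFabc ▸ hSF⟩
  have hmcl : m ∈ closure F := by
    have h1 : (0 : ℝ) ∈ closure (Set.Ioo 0 ε) := by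
      rw [closure_Ioo hε.ne]; exact ⟨le_rfl, hε.le⟩
    have := map_mem_closure hcont h1 hSF
    simpa using this
  have hmhull : m ∈ convexHull ℝ ({a, b, c} : Set (ℝ × ℝ)) := by
    refine closure_minimal ?_ (isCompact_triangle a b c).isClosed hmcl
    rw [hFabc]; exact openTriangle_subset a b c
  rcases triangle_subset (IsTriangle.cross_ne_zero ⟨hab, hbc, hac⟩ hE) hmhull with
    h | (h | h) | h
  · exact absurd (hFabc ▸ h) hmF
  · exact key a b c hab hbc hac hFabc h
  · refine key b c a hbc (G.symm _ _ hac) (G.symm _ _ hab) ?_ h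
    rw [hFabc, openTriangle_swap, openTriangle_swap_right]
  · refine key c a b (G.symm _ _ hac) hab (G.symm _ _ hbc) ?_ h
    rw [hFabc, openTriangle_swap_right, openTriangle_swap]

/-- An edge inside a triangle lies on two triangular faces. -/
lemma exists_two_common_neighbors {p q r x y : ℝ × ℝ} (hE : G.IsEmbedded)
    (hF : G.InnerFacesTriangles) (ht : G.IsTriangle p q r) (hxy : G.Adj x y)
    (hx : x ∈ openTriangle p q r) (hy : y ∈ openTriangle p q r) :
    ∃ z₁ z₂, z₁ ≠ z₂ ∧ G.Adj x z₁ ∧ G.Adj y z₁ ∧ G.Adj x z₂ ∧ G.Adj y z₂ := by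
  have hm : midpoint ℝ x y ∈ openTriangle p q r :=
    (convex_openTriangle p q r).segment_subset hx hy (midpoint_mem_segment x y)
  let d : ℝ × ℝ := (-(y.2 - x.2), y.1 - x.1)
  have hd : 0 < cross x y (x + d) := by
    have h1 : cross x y (x + d) = (y.1 - x.1) ^ 2 + (y.2 - x.2) ^ 2 := by
      simp only [cross, d, Prod.fst_add, Prod.snd_add]; ring
    have h2 : y.1 - x.1 ≠ 0 ∨ y.2 - x.2 ≠ 0 := by
      by_contra! hc
      exact hxy.ne (Prod.ext (by linarith [hc.1]) (by linarith [hc.2]))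
    rw [h1]
    rcases h2 with h2 | h2 <;> positivity
  have hd' : cross x y (x + -d) ≠ 0 := by
    have : cross x y (x + -d) = -cross x y (x + d) := by
      simp only [cross, Prod.fst_add, Prod.snd_add, Prod.fst_neg, Prod.snd_neg]; ring
    rw [this]; exact neg_ne_zero.mpr hd.ne'
  obtain ⟨z₁, hxz₁, hyz₁, hm₁, ε₁, hε₁, h₁⟩ := exists_face_beside hE hF ht hxy hm hd.ne'
  obtain ⟨z₂, hxz₂, hyz₂, -, ε₂, hε₂, h₂⟩ := exists_face_beside hE hF ht hxy hm hd'
  refine ⟨z₁, z₂, ?_, hxz₁, hyz₁, hxz₂, hyz₂⟩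
  rintro rfl
  set t := min ε₁ ε₂ / 2
  have hlt : t < min ε₁ ε₂ := half_lt_self (lt_min hε₁ hε₂)
  have hpos : 0 < t := half_pos (lt_min hε₁ hε₂)
  have hmid := (convex_openTriangle x y z₁).segment_subset
    (h₁ t ⟨hpos, hlt.trans_le (min_le_left _ _)⟩) (h₂ t ⟨hpos, hlt.trans_le (min_le_right _ _)⟩)
    (midpoint_mem_segment _ _)
  refine hm₁ ?_
  convert hmid using 1
  rw [smul_neg, ← sub_eq_add_neg, midpoint_add_sub]


/-- The corners of the central triangle of the exceptional graphs. -/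
def centralTriangle : Finset (Fin 12) := {0, 4, 8}

/-- The properties of the exceptional graphs used below: the side `w (w+4)` of the central
triangle cuts off the ear `w+1, w+2, w+3`. -/
structure HasEars (H : SimpleGraph (Fin 12)) : Prop where
  adj_succ : ∀ k, H.Adj k (k + 1)
  common_unique : ∀ k x y, H.Adj k x → H.Adj (k + 1) x → H.Adj k y → H.Adj (k + 1) y → x = y
  adj_add_four : ∀ w ∈ centralTriangle, H.Adj w (w + 4)
  exists_apex : ∀ w ∈ centralTriangle, ∃ j < 3,
    H.Adj w (w + 1 + Fin.ofNat 12 j) ∧ H.Adj (w + 4) (w + 1 + Fin.ofNat 12 j)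
  dominate_but_ear : ∀ w ∈ centralTriangle, ∃ x y z, x ≠ y ∧ x ≠ z ∧ y ≠ z ∧
    ∀ k, k = w ∨ k = w + 4 ∨ (∃ j < 3, k = w + 1 + Fin.ofNat 12 j) ∨
      H.Adj k x ∨ H.Adj k y ∨ H.Adj k z
  dominate_ear : ∀ w ∈ centralTriangle, ∃ x y z, x ≠ y ∧ x ≠ z ∧ y ≠ z ∧
    ∀ k, k = w ∨ k = w + 4 ∨ (∃ j < 7, k = w + 5 + Fin.ofNat 12 j) ∨
      H.Adj k x ∨ H.Adj k y ∨ H.Adj k z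
  dominate_but_one : ∀ a ∉ centralTriangle, ∃ x y z, a ≠ x ∧ a ≠ y ∧ a ≠ z ∧
    x ≠ y ∧ x ≠ z ∧ y ≠ z ∧
    ∀ k, k = a ∨ H.Adj k a ∨ H.Adj k x ∨ H.Adj k y ∨ H.Adj k z

instance : DecidableRel H1graph.Adj := fun a b =>
  inferInstanceAs (Decidable (a ≠ b ∧ ((a, b) ∈ exc1Edges ∨ (b, a) ∈ exc1Edges)))

instance : DecidableRel H2graph.Adj := fun a b =>
  inferInstanceAs (Decidable (a ≠ b ∧ ((a, b) ∈ exc2Edges ∨ (b, a) ∈ exc2Edges)))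

lemma hasEars_H1graph : HasEars H1graph := by
  constructor <;> decide +kernel

lemma hasEars_H2graph : HasEars H2graph := by
  constructor <;> decide +kernel

/-- `G` consists of the adjacent vertices `u`, `v` and a copy of `H` on the vertices `g k`. -/
structure IsPairExtension (G : PlaneGraph) (H : SimpleGraph (Fin 12)) (u v : ℝ × ℝ)
    (g : Fin 12 → ℝ × ℝ) : Prop where
  injective : Function.Injective g
  adj_iff : ∀ i j, G.Adj (g i) (g j) ↔ H.Adj i j
  mem : ∀ i, g i ∈ G.verts
  ne_left : ∀ i, g i ≠ u
  ne_right : ∀ i, g i ≠ v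
  cover : ∀ x ∈ G.verts, x = u ∨ x = v ∨ ∃ i, x = g i
  adj_pair : G.Adj u v

variable {G : PlaneGraph} {H : SimpleGraph (Fin 12)} {u v p q r : ℝ × ℝ} {g : Fin 12 → ℝ × ℝ}

lemma exists_isPairExtension (huv : G.Adj u v) (h : (G.deleteVerts {u, v}).IsIsoToSG H) :
    ∃ g, G.IsPairExtension H u v g := by
  obtain ⟨f, hf, hadj⟩ := h
  choose g hg hfg using fun k => hf.surjOn (Set.mem_univ k)
  have hmem : ∀ k, g k ∈ G.verts ∧ g k ∉ ({u, v} : Finset (ℝ × ℝ)) := fun k =>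
    Finset.mem_sdiff.mp (hg k)
  refine ⟨g, fun i j hij => ?_, fun i j => ?_, fun i => (hmem i).1, fun i hi => ?_,
    fun i hi => ?_, fun x hx => ?_, huv⟩
  · rw [← hfg i, hij, hfg j]
  · rw [← hfg i, ← hfg j, ← hadj _ (hg i) _ (hg j), hfg, hfg]
    exact ⟨fun h => ⟨h, (hmem i).2, (hmem j).2⟩, fun h => h.1⟩
  · exact (hmem i).2 (by simp [hi])
  · exact (hmem i).2 (by simp [hi])
  · by_cases hx' : x ∈ ({u, v} : Finset (ℝ × ℝ))
    · simp only [Finset.mem_insert, Finset.mem_singleton] at hx'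
      tauto
    · have hxd : x ∈ (G.deleteVerts {u, v}).verts := Finset.mem_sdiff.mpr ⟨hx, hx'⟩
      exact Or.inr (Or.inr ⟨f x, hf.injOn hxd (hg _) (hfg _).symm⟩)

namespace IsPairExtension

lemma adj_right_of_path (hX : G.IsPairExtension H u v g) (hH : HasEars H) (hE : G.IsEmbedded)
    (hF : G.InnerFacesTriangles) (hu : ∀ k, G.Adj u (g k) → k ∈ centralTriangle)
    (ht : G.IsTriangle p q r) {s : Fin 12} {l : ℕ} (hl : 1 < l)
    (havoid : ∀ j < l, g (s + Fin.ofNat 12 j) ≠ p ∧ g (s + Fin.ofNat 12 j) ≠ q ∧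
      g (s + Fin.ofNat 12 j) ≠ r)
    {i : ℕ} (hi : i < l) (hin : g (s + Fin.ofNat 12 i) ∈ openTriangle p q r) :
    ∀ j < l, g (s + Fin.ofNat 12 j) ∈ openTriangle p q r ∧ G.Adj v (g (s + Fin.ofNat 12 j)) := by
  have hsucc : ∀ j, s + Fin.ofNat 12 (j + 1) = s + Fin.ofNat 12 j + 1 := fun j => by
    apply Fin.ext; simp [Fin.val_add]; omega
  have hadj : ∀ j, G.Adj (g (s + Fin.ofNat 12 j)) (g (s + Fin.ofNat 12 (j + 1))) := fun j => by
    rw [hX.adj_iff, hsucc]; exact hH.adj_succ _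
  have hstep : ∀ j, j + 1 < l → (g (s + Fin.ofNat 12 j) ∈ openTriangle p q r ↔
      g (s + Fin.ofNat 12 (j + 1)) ∈ openTriangle p q r) := by
    intro j hj
    obtain ⟨h1, h2, h3⟩ := havoid j (by omega)
    obtain ⟨h4, h5, h6⟩ := havoid (j + 1) hj
    exact ⟨fun h => ht.mem_of_adj hE (hadj j) h h1 h2 h3 h4 h5 h6,
      fun h => ht.mem_of_adj hE (G.symm _ _ (hadj j)) h h4 h5 h6 h1 h2 h3⟩
  have hzero : ∀ j < l, (g (s + Fin.ofNat 12 j) ∈ openTriangle p q r ↔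
      g (s + Fin.ofNat 12 0) ∈ openTriangle p q r) := by
    intro j
    induction j with
    | zero => exact fun _ => Iff.rfl
    | succ j ih => exact fun hj => (hstep j hj).symm.trans (ih (by omega))
  have hall : ∀ j < l, g (s + Fin.ofNat 12 j) ∈ openTriangle p q r := fun j hj =>
    (hzero j hj).mpr ((hzero i hi).mp hin)
  have hedge : ∀ j, j + 1 < l → G.Adj v (g (s + Fin.ofNat 12 j)) ∧
      G.Adj v (g (s + Fin.ofNat 12 (j + 1))) := by
    intro j hj
    obtain ⟨z₁, z₂, hne, h1, h2, h3, h4⟩ := exists_two_common_neighbors hE hF ht (hadj j)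
      (hall j (by omega)) (hall (j + 1) hj)
    have hnot_u : ∀ z, G.Adj (g (s + Fin.ofNat 12 j)) z →
        G.Adj (g (s + Fin.ofNat 12 (j + 1))) z → z ≠ u := by
      rintro z hz hz' rfl
      have a := hu _ (G.symm _ _ hz)
      have b := hu _ (G.symm _ _ hz')
      rw [hsucc] at b
      generalize s + Fin.ofNat 12 j = k at a b
      revert k; decide
    by_cases hv₁ : z₁ = v
    · subst hv₁; exact ⟨G.symm _ _ h1, G.symm _ _ h2⟩
    by_cases hv₂ : z₂ = v
    · subst hv₂; exact ⟨G.symm _ _ h3, G.symm _ _ h4⟩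
    exfalso
    rcases hX.cover z₁ (G.mem_of_adj _ _ h1).2 with h | h | ⟨a, rfl⟩
    · exact hnot_u _ h1 h2 h
    · exact hv₁ h
    rcases hX.cover z₂ (G.mem_of_adj _ _ h3).2 with h | h | ⟨b, rfl⟩
    · exact hnot_u _ h3 h4 h
    · exact hv₂ h
    rw [hX.adj_iff] at h1 h2 h3 h4
    rw [hsucc] at h2 h4
    exact hne (congrArg g (hH.common_unique _ _ _ h1 h2 h3 h4))
  intro j hj
  refine ⟨hall j hj, ?_⟩
  rcases j with - | j
  · exact (hedge 0 hl).1
  · exact (hedge j hj).2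

/-- No path of the boundary cycle of `H` lies inside a triangle of `H`. -/
lemma not_mem_of_path (hX : G.IsPairExtension H u v g) (hH : HasEars H) (hE : G.IsEmbedded)
    (hF : G.InnerFacesTriangles) (hu : ∀ k, G.Adj u (g k) → k ∈ centralTriangle)
    (hout : u ∈ frontier G.outerRegion) {a b c : Fin 12}
    (ht : G.IsTriangle (g a) (g b) (g c)) {s : Fin 12} {l : ℕ} (hl : 1 < l)
    (havoid : ∀ j < l, s + Fin.ofNat 12 j ≠ a ∧ s + Fin.ofNat 12 j ≠ b ∧
      s + Fin.ofNat 12 j ≠ c) {i : ℕ} (hi : i < l) :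
    g (s + Fin.ofNat 12 i) ∉ openTriangle (g a) (g b) (g c) := by
  intro hin
  have havoid' : ∀ j < l, g (s + Fin.ofNat 12 j) ≠ g a ∧ g (s + Fin.ofNat 12 j) ≠ g b ∧
      g (s + Fin.ofNat 12 j) ≠ g c := fun j hj => by
    simpa only [hX.injective.ne_iff] using havoid j hj
  obtain ⟨-, hv⟩ := hX.adj_right_of_path hH hE hF hu ht hl havoid' hi hin i hi
  obtain ⟨h1, h2, h3⟩ := havoid' i hi
  have hvin := ht.mem_of_adj hE (G.symm _ _ hv) hin h1 h2 h3 (hX.ne_right a).symm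
    (hX.ne_right b).symm (hX.ne_right c).symm
  exact ht.not_mem_of_mem_frontier hE hout (ht.mem_of_adj hE (G.symm _ _ hX.adj_pair) hvin
    (hX.ne_right a).symm (hX.ne_right b).symm (hX.ne_right c).symm (hX.ne_left a).symm
    (hX.ne_left b).symm (hX.ne_left c).symm)

/-- If the neighbors of `u` in `H` are corners of the central triangle, among them the ends of
the side `w (w+4)`, then `v` is adjacent to all vertices on one side of that edge. -/
lemma adj_right_of_side (hX : G.IsPairExtension H u v g) (hH : HasEars H) (hE : G.IsEmbedded)
    (hF : G.InnerFacesTriangles) (hu : ∀ k, G.Adj u (g k) → k ∈ centralTriangle)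
    (hout : u ∈ frontier G.outerRegion) {w : Fin 12} (hw : w ∈ centralTriangle)
    (hwu : G.Adj u (g w)) (hwu' : G.Adj u (g (w + 4))) :
    (∀ j < 3, G.Adj v (g (w + 1 + Fin.ofNat 12 j))) ∨
      ∀ j < 7, G.Adj v (g (w + 5 + Fin.ofNat 12 j)) := by
  obtain ⟨i, hi, hwd, hwd'⟩ := hH.exists_apex w hw
  have hside : G.Adj (g w) (g (w + 4)) := (hX.adj_iff _ _).mpr (hH.adj_add_four w hw)
  have h8 : w + 5 + Fin.ofNat 12 3 = w + 8 := by clear * -; revert w; decide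
  have hc : H.Adj (w + 4) (w + 8) ∧ H.Adj w (w + 8) := by
    have h1 := hH.adj_add_four (w + 4) (by clear * - hw; revert w; decide)
    have h2 := hH.adj_add_four (w + 8) (by clear * - hw; revert w; decide)
    rw [show w + 4 + 4 = w + 8 by clear * -; revert w; decide] at h1
    rw [show w + 8 + 4 = w by clear * -; revert w; decide] at h2
    exact ⟨h1, h2.symm⟩
  have tc : G.IsTriangle (g w) (g (w + 4)) (g (w + 5 + Fin.ofNat 12 3)) := by
    rw [h8]; exact ⟨hside, (hX.adj_iff _ _).mpr hc.1, (hX.adj_iff _ _).mpr hc.2⟩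
  have td : G.IsTriangle (g w) (g (w + 4)) (g (w + 1 + Fin.ofNat 12 i)) :=
    ⟨hside, (hX.adj_iff _ _).mpr hwd', (hX.adj_iff _ _).mpr hwd⟩
  have tu : G.IsTriangle (g w) (g (w + 4)) u := ⟨hside, G.symm _ _ hwu', G.symm _ _ hwu⟩
  have hear : ∀ w : Fin 12, ∀ j < 3, w + 1 + Fin.ofNat 12 j ≠ w ∧
      w + 1 + Fin.ofNat 12 j ≠ w + 4 ∧ ∀ i < 7, w + 1 + Fin.ofNat 12 j ≠ w + 5 + Fin.ofNat 12 i := by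
    decide
  have hrest : ∀ w : Fin 12, ∀ j < 7, w + 5 + Fin.ofNat 12 j ≠ w ∧
      w + 5 + Fin.ofNat 12 j ≠ w + 4 := by
    decide
  have hdc : g (w + 1 + Fin.ofNat 12 i) ∉ openTriangle (g w) (g (w + 4)) _ :=
    hX.not_mem_of_path hH hE hF hu hout tc (l := 3) (by norm_num)
      (fun j hj => ⟨(hear w j hj).1, (hear w j hj).2.1, (hear w j hj).2.2 3 (by norm_num)⟩) hi
  have hcd : g (w + 5 + Fin.ofNat 12 3) ∉ openTriangle (g w) (g (w + 4)) _ :=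
    hX.not_mem_of_path hH hE hF hu hout td (l := 7) (by norm_num)
      (fun j hj => ⟨(hrest w j hj).1, (hrest w j hj).2, ((hear w i hi).2.2 j hj).symm⟩)
      (by norm_num)
  have hpos : ∀ x y z : ℝ, x ≠ 0 → y ≠ 0 → z ≠ 0 → 0 < x * y ∨ 0 < x * z ∨ 0 < y * z := by
    intro x y z hx hy hz
    rcases hx.lt_or_gt with hx | hx <;> rcases hy.lt_or_gt with hy | hy <;>
      rcases hz.lt_or_gt with hz | hz <;>
      simp only [mul_pos, mul_pos_of_neg_of_neg, hx, hy, hz, true_or, or_true]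
  rcases hpos _ _ _ (td.cross_ne_zero hE) (tc.cross_ne_zero hE) (tu.cross_ne_zero hE) with
    h | h | h
  · rcases td.nested tc hE (hX.injective.ne ((hear w i hi).2.2 3 (by norm_num))) h with h | h
    exacts [absurd h hdc, absurd h hcd]
  · rcases td.nested tu hE (hX.ne_left _) h with h | h
    · left
      intro j hj
      refine (hX.adj_right_of_path hH hE hF hu tu (by norm_num) (fun j hj => ⟨?_, ?_, ?_⟩) hi h
        j hj).2
      · exact hX.injective.ne (hear w j hj).1
      · exact hX.injective.ne (hear w j hj).2.1
      · exact hX.ne_left _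
    · exact absurd h (td.not_mem_of_mem_frontier hE hout)
  · rcases tc.nested tu hE (hX.ne_left _) h with h | h
    · right
      intro j hj
      refine (hX.adj_right_of_path hH hE hF hu tu (l := 7) (by norm_num)
        (fun j hj => ⟨?_, ?_, ?_⟩) (by norm_num) h j hj).2
      · exact hX.injective.ne (hrest w j hj).1
      · exact hX.injective.ne (hrest w j hj).2
      · exact hX.ne_left _
    · exact absurd h (tc.not_mem_of_mem_frontier hE hout)

/-- The set `{u, v, g x, g y, g z}` is totally dominating as soon as it dominates `H`. -/
lemma exists_TDS_of_right (hX : G.IsPairExtension H u v g) {x y z : Fin 12} (hxy : x ≠ y)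
    (hxz : x ≠ z) (hyz : y ≠ z)
    (hdom : ∀ k, G.Adj u (g k) ∨ G.Adj v (g k) ∨ H.Adj k x ∨ H.Adj k y ∨ H.Adj k z) :
    ∃ D : Finset (ℝ × ℝ), G.IsTDS D ∧ D.card = 5 ∧ u ∈ D := by
  have huv := hX.adj_pair
  have hmem := G.mem_of_adj _ _ huv
  refine ⟨{u, v, g x, g y, g z}, ⟨?_, ?_⟩, ?_, by simp⟩
  · intro t ht
    simp only [Finset.mem_insert, Finset.mem_singleton] at ht
    rcases ht with rfl | rfl | rfl | rfl | rfl
    exacts [hmem.1, hmem.2, hX.mem _, hX.mem _, hX.mem _]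
  · intro t ht
    rcases hX.cover t ht with rfl | rfl | ⟨k, rfl⟩
    · exact ⟨v, by simp, huv⟩
    · exact ⟨u, by simp, G.symm _ _ huv⟩
    · rcases hdom k with h | h | h | h | h
      · exact ⟨u, by simp, G.symm _ _ h⟩
      · exact ⟨v, by simp, G.symm _ _ h⟩
      · exact ⟨g x, by simp, (hX.adj_iff _ _).mpr h⟩
      · exact ⟨g y, by simp, (hX.adj_iff _ _).mpr h⟩
      · exact ⟨g z, by simp, (hX.adj_iff _ _).mpr h⟩
  · simp [Finset.card_insert_of_notMem, hX.injective.eq_iff, hxy, hxz, hyz, huv.ne,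
      (hX.ne_left _).symm, (hX.ne_right _).symm]

/-- If `u` has a neighbor `g a` off the central triangle, then `u`, `g a` and three further
vertices of `H` form a total dominating set. -/
lemma exists_TDS_of_not_mem (hX : G.IsPairExtension H u v g) (hH : HasEars H) {a : Fin 12}
    (hua : G.Adj u (g a)) (ha : a ∉ centralTriangle) :
    ∃ D : Finset (ℝ × ℝ), G.IsTDS D ∧ D.card = 5 ∧ u ∈ D := by
  obtain ⟨x, y, z, hax, hay, haz, hxy, hxz, hyz, hdom⟩ := hH.dominate_but_one a ha
  refine ⟨{u, g a, g x, g y, g z}, ⟨?_, ?_⟩, ?_, by simp⟩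
  · intro t ht
    simp only [Finset.mem_insert, Finset.mem_singleton] at ht
    rcases ht with rfl | rfl | rfl | rfl | rfl
    exacts [(G.mem_of_adj _ _ hua).1, hX.mem _, hX.mem _, hX.mem _, hX.mem _]
  · intro t ht
    rcases hX.cover t ht with rfl | rfl | ⟨k, rfl⟩
    · exact ⟨g a, by simp, hua⟩
    · exact ⟨u, by simp, G.symm _ _ hX.adj_pair⟩
    · rcases hdom k with rfl | h | h | h | h
      · exact ⟨u, by simp, G.symm _ _ hua⟩
      · exact ⟨g a, by simp, (hX.adj_iff _ _).mpr h⟩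
      · exact ⟨g x, by simp, (hX.adj_iff _ _).mpr h⟩
      · exact ⟨g y, by simp, (hX.adj_iff _ _).mpr h⟩
      · exact ⟨g z, by simp, (hX.adj_iff _ _).mpr h⟩
  · simp [Finset.card_insert_of_notMem, hX.injective.eq_iff, hax, hay, haz, hxy, hxz, hyz,
      (hX.ne_left _).symm]

lemma exists_TDS (hX : G.IsPairExtension H u v g) (hH : HasEars H) (hE : G.IsEmbedded)
    (hF : G.InnerFacesTriangles) (hout : u ∈ frontier G.outerRegion) {a b : Fin 12}
    (hab : a ≠ b) (hua : G.Adj u (g a)) (hub : G.Adj u (g b)) :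
    ∃ D : Finset (ℝ × ℝ), G.IsTDS D ∧ D.card = 5 ∧ u ∈ D := by
  by_cases hu : ∀ k, G.Adj u (g k) → k ∈ centralTriangle
  swap
  · push Not at hu
    obtain ⟨k, hk, hk'⟩ := hu
    exact hX.exists_TDS_of_not_mem hH hk hk'
  obtain ⟨w, hw, hwu, hwu'⟩ : ∃ w ∈ centralTriangle, G.Adj u (g w) ∧ G.Adj u (g (w + 4)) := by
    have : ∀ a ∈ centralTriangle, ∀ b ∈ centralTriangle, a ≠ b → b = a + 4 ∨ a = b + 4 := by
      decide
    rcases this a (hu a hua) b (hu b hub) hab with rfl | rfl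
    exacts [⟨a, hu a hua, hua, hub⟩, ⟨b, hu b hub, hub, hua⟩]
  rcases hX.adj_right_of_side hH hE hF hu hout hw hwu hwu' with hv | hv
  · obtain ⟨x, y, z, hxy, hxz, hyz, hdom⟩ := hH.dominate_but_ear w hw
    refine hX.exists_TDS_of_right hxy hxz hyz fun k => ?_
    rcases hdom k with rfl | rfl | ⟨j, hj, rfl⟩ | h
    exacts [Or.inl hwu, Or.inl hwu', Or.inr (Or.inl (hv j hj)), Or.inr (Or.inr h)]
  · obtain ⟨x, y, z, hxy, hxz, hyz, hdom⟩ := hH.dominate_ear w hw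
    refine hX.exists_TDS_of_right hxy hxz hyz fun k => ?_
    rcases hdom k with rfl | rfl | ⟨j, hj, rfl⟩ | h
    exacts [Or.inl hwu, Or.inl hwu', Or.inr (Or.inl (hv j hj)), Or.inr (Or.inr h)]

end IsPairExtension

end PlaneGraph

/-- Let `T` be a near-triangulation with boundary cycle
`C = (u_1, …, u_h, u_1)` and let `u_i` be a boundary vertex.  If there exists an interior
vertex `v_i` adjacent to `u_i` such that `T − {u_i, v_i}` is isomorphic to `H₁` or `H₂`, then
`T` has a total dominating set of size 5 containing `u_i`. -/
theorem TDS_of_deleteVertPair_exceptional (T : PlaneGraph) (h : ℕ) (u : ZMod h → ℝ × ℝ)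
    (i : ZMod h) (hT : T.IsNearTriangulation) (hu : T.IsBoundaryCycle u)
    (hexc : ∃ v : ℝ × ℝ, T.IsInteriorVtx u v ∧ T.Adj (u i) v ∧
      (T.deleteVerts {u i, v}).IsExceptional) :
    ∃ D : Finset (ℝ × ℝ), T.IsTDS D ∧ D.card = 5 ∧ u i ∈ D := by
  obtain ⟨hE, -, hF⟩ := hT
  obtain ⟨hh, hinj, -, hadj, hfr, -⟩ := hu
  obtain ⟨v, ⟨-, hv⟩, huv, hexc⟩ := hexc
  obtain ⟨H, hH, hiso⟩ : ∃ H, PlaneGraph.HasEars H ∧ (T.deleteVerts {u i, v}).IsIsoToSG H := by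
    rcases hexc with hiso | hiso
    exacts [⟨_, PlaneGraph.hasEars_H1graph, hiso⟩, ⟨_, PlaneGraph.hasEars_H2graph, hiso⟩]
  obtain ⟨g, hX⟩ := PlaneGraph.exists_isPairExtension huv hiso
  have hnext : T.Adj (u i) (u (i + 1)) := hadj i
  have hprev : T.Adj (u i) (u (i - 1)) := by
    have := hadj (i - 1)
    rw [sub_add_cancel] at this
    exact T.symm _ _ this
  have hne : u (i + 1) ≠ u (i - 1) := by
    intro heq
    have h2 : ((2 : ℕ) : ZMod h) = 0 := by
      have := hinj heq
      push_cast
      linear_combination this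
    have := Nat.le_of_dvd two_pos ((ZMod.natCast_eq_zero_iff _ _).mp h2)
    omega
  have hlabel : ∀ j, T.Adj (u i) (u j) → ∃ k, u j = g k := by
    intro j hj
    rcases hX.cover _ (T.mem_of_adj _ _ hj).2 with hk | hk | hk
    · exact absurd (hk ▸ hj) (T.loopless _)
    · exact absurd ⟨j, hk⟩ hv
    · exact hk
  obtain ⟨a, ha⟩ := hlabel _ hnext
  obtain ⟨b, hb⟩ := hlabel _ hprev
  rw [ha] at hnext
  rw [hb] at hprev
  refine hX.exists_TDS hH hE hF (hfr i (left_mem_segment ℝ _ _)) (a := a) (b := b) ?_ hnext hprev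
  rintro rfl
  exact hne (ha.trans hb.symm)
end
end

section
/- Let T be a near-triangulation with boundary cycle C = (u_1, ..., u_h, u_1) and let u_i be a boundary vertex. If there exists an edge e incident with u_i such that the contracted graph T/e is isomorphic to H_1 or H_2, then T has a total dominating set of size 5 containing u_i. -/
/-!
Common definitions.

A *plane graph* is a finite graph whose vertices are points of the plane `ℝ × ℝ` and whose
edges are drawn as straight-line segments between their endpoints (by Fáry's theorem every
planar graph admits such a drawing).  A *near-triangulation* is a plane graph that is properly
embedded, biconnected, and all of whose bounded faces are triangles (the faces are the
connected components of the complement of the drawing).  The boundary cycle lists, cyclically,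
the vertices on the outer (unbounded) face.
-/

open scoped Classical

noncomputable section

theorem mem_convexHull_triple_iff {E : Type*} [AddCommGroup E] [Module ℝ E] {a b c x : E} :
    x ∈ convexHull ℝ {a, b, c} ↔ ∃ α β γ : ℝ, 0 ≤ α ∧ 0 ≤ β ∧ 0 ≤ γ ∧ α + β + γ = 1 ∧
      α • a + β • b + γ • c = x := by
  constructor
  · rw [convexHull_insert (Set.insert_nonempty _ _), convexHull_pair, mem_convexJoin]
    rintro ⟨_, rfl, y, ⟨s, t, hs, ht, hst, rfl⟩, α, β, hα, hβ, hαβ, rfl⟩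
    refine ⟨α, β * s, β * t, hα, by positivity, by positivity, ?_, ?_⟩
    · rw [add_assoc, ← mul_add, hst, mul_one, hαβ]
    · module
  · rintro ⟨α, β, γ, hα, hβ, hγ, hsum, rfl⟩
    have hconv := convex_convexHull ℝ ({a, b, c} : Set E)
    have ha : a ∈ convexHull ℝ ({a, b, c} : Set E) := subset_convexHull _ _ (by simp)
    have hb : b ∈ convexHull ℝ ({a, b, c} : Set E) := subset_convexHull _ _ (by simp)
    have hc : c ∈ convexHull ℝ ({a, b, c} : Set E) := subset_convexHull _ _ (by simp)
    have := hconv.sum_mem (t := Finset.univ) (w := ![α, β, γ]) (z := ![a, b, c])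
      (by intro i _; fin_cases i <;> simpa) (by simpa [Fin.sum_univ_three])
      (by intro i _; fin_cases i <;> simpa)
    simpa [Fin.sum_univ_three] using this

/-- A point of a nondegenerate triangle that is not interior lies on one of its sides. -/
theorem mem_segment_of_mem_convexHull_triple {E : Type*} [AddCommGroup E] [Module ℝ E]
    [TopologicalSpace E] [IsTopologicalAddGroup E] [ContinuousConstSMul ℝ E] {a b c v x : E}
    (hx : x ∈ interior (convexHull ℝ {a, b, c})) (hv : v ∈ convexHull ℝ {a, b, c})
    (hvi : v ∉ interior (convexHull ℝ {a, b, c})) :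
    v ∈ segment ℝ a b ∨ v ∈ segment ℝ b c ∨ v ∈ segment ℝ a c := by
  obtain ⟨α, β, γ, hα, hβ, hγ, hsum, rfl⟩ := mem_convexHull_triple_iff.1 hv
  rcases hα.eq_or_lt with rfl | hα
  · exact Or.inr (Or.inl ⟨β, γ, hβ, hγ, by linarith, by module⟩)
  rcases hβ.eq_or_lt with rfl | hβ
  · exact Or.inr (Or.inr ⟨α, γ, hα.le, hγ, by linarith, by module⟩)
  rcases hγ.eq_or_lt with rfl | hγ
  · exact Or.inl ⟨α, β, hα.le, hβ.le, by linarith, by module⟩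
  refine absurd ?_ hvi
  obtain ⟨α', β', γ', hα', hβ', hγ', hsum', hx'⟩ :=
    mem_convexHull_triple_iff.1 (interior_subset hx)
  obtain ⟨δ, hδ, hδα, hδβ, hδγ⟩ : ∃ δ : ℝ, 0 < δ ∧ δ ≤ α ∧ δ ≤ β ∧ δ ≤ γ :=
    ⟨min α (min β γ), by positivity, by simp, by simp, by simp⟩
  have hy : (α + δ * (α - α')) • a + (β + δ * (β - β')) • b + (γ + δ * (γ - γ')) • c ∈
      convexHull ℝ {a, b, c} :=
    mem_convexHull_triple_iff.2 ⟨_, _, _, by nlinarith, by nlinarith, by nlinarith,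
      by linear_combination (1 + δ) * hsum - δ * hsum', rfl⟩
  have hδ' : 1 + δ ≠ 0 := by positivity
  have := (convex_convexHull ℝ _).combo_interior_self_mem_interior hx hy
    (a := δ / (1 + δ)) (b := 1 / (1 + δ)) (by positivity) (by positivity) (by field_simp; ring)
  convert this using 1
  rw [← hx']
  match_scalars <;> field_simp <;> ring

theorem isClosed_segment_real (a b : ℝ × ℝ) : IsClosed (segment ℝ a b) := by
  rw [← convexHull_pair]
  exact (Set.toFinite _).isClosed_convexHull ℝ

/-- Any two vectors of the plane, one of them nonzero, lie in a common closed half-plane. -/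
theorem exists_linearMap_nonneg {a b : ℝ × ℝ} (ha : a ≠ 0) :
    ∃ (φ : ℝ × ℝ →ₗ[ℝ] ℝ) (n : ℝ × ℝ), 0 ≤ φ a ∧ 0 ≤ φ b ∧ φ n < 0 := by
  set ψ : ℝ × ℝ →ₗ[ℝ] ℝ := a.1 • LinearMap.snd ℝ ℝ ℝ - a.2 • LinearMap.fst ℝ ℝ ℝ with hψ
  have hψa : ψ a = 0 := by simp [hψ]; ring
  have hn : 0 < ψ (-a.2, a.1) := by
    have : a.1 ≠ 0 ∨ a.2 ≠ 0 := by
      by_contra! h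
      exact ha (Prod.ext h.1 h.2)
    simp only [hψ, LinearMap.sub_apply, LinearMap.smul_apply, LinearMap.snd_apply,
      LinearMap.fst_apply, smul_eq_mul]
    rcases this with h | h <;> nlinarith [mul_self_pos.2 h, mul_self_nonneg a.1, mul_self_nonneg a.2]
  rcases le_total 0 (ψ b) with hb | hb
  · exact ⟨ψ, -(-a.2, a.1), hψa.ge, hb, by rw [map_neg]; linarith⟩
  · exact ⟨-ψ, (-a.2, a.1), by simp [hψa], by simpa using hb, by simpa using hn⟩

namespace PlaneGraph

variable {G : PlaneGraph}

/-- Sufficiently close to a vertex, the drawing consists only of the edges at that vertex. -/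
theorem eventually_notMem_segment (hE : G.IsEmbedded) {v : ℝ × ℝ} (hv : v ∈ G.verts) :
    ∀ᶠ x in nhds v, ∀ p q, G.Adj p q → p ≠ v → q ≠ v → x ∉ segment ℝ p q := by
  have key : ∀ᶠ x in nhds v, ∀ e ∈ G.verts ×ˢ G.verts, G.Adj e.1 e.2 → e.1 ≠ v → e.2 ≠ v →
      x ∉ segment ℝ e.1 e.2 := by
    rw [Filter.eventually_all_finset]
    rintro ⟨p, q⟩ -
    by_cases h : G.Adj p q ∧ p ≠ v ∧ q ≠ v
    · have hvs : v ∉ segment ℝ p q := fun hs =>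
        (hE.2 p q v h.1 hv hs).elim (fun e => h.2.1 e.symm) fun e => h.2.2 e.symm
      filter_upwards [(isClosed_segment_real p q).isOpen_compl.mem_nhds hvs] with x hx _ _ _
      exact hx
    · exact Filter.Eventually.of_forall fun x h₁ h₂ h₃ => absurd ⟨h₁, h₂, h₃⟩ h
  filter_upwards [key] with x hx p q hpq
  exact hx (p, q) (Finset.mem_product.2 (G.mem_of_adj p q hpq)) hpq

/-- A vertex all of whose neighbours are among two vertices lies on the outer face. -/
theorem mem_frontier_outerRegion (hE : G.IsEmbedded) (hF : G.InnerFacesTriangles)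
    {v a b : ℝ × ℝ} (hva : G.Adj v a) (hN : ∀ w, G.Adj v w → w = a ∨ w = b) :
    v ∈ frontier G.outerRegion := by
  have hvV := (G.mem_of_adj v a hva).1
  have hvD : v ∈ G.drawing := ⟨v, a, hva, left_mem_segment ℝ v a⟩
  have hav : a - v ≠ 0 := sub_ne_zero.2 fun e => G.loopless v (e ▸ hva)
  obtain ⟨φ, n, hφa, hφb, hφn⟩ := exists_linearMap_nonneg (b := b - v) hav
  have hφN : ∀ w, G.Adj v w → φ v ≤ φ w := by
    intro w hw
    rw [map_sub, sub_nonneg] at hφa hφb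
    rcases hN w hw with rfl | rfl <;> assumption
  have hhalf : Convex ℝ {y | φ v ≤ φ y} := convex_halfSpace_ge φ.isLinear _
  have hφt : ∀ t : ℝ, 0 < t → φ (v + t • n) < φ v := by
    intro t ht
    rw [map_add, map_smul, smul_eq_mul]
    nlinarith
  have htend : Filter.Tendsto (fun t : ℝ => v + t • n) (nhdsWithin 0 (Set.Ioi 0)) (nhds v) := by
    have : Continuous fun t : ℝ => v + t • n := by fun_prop
    simpa using (this.tendsto 0).mono_left nhdsWithin_le_nhds
  obtain ⟨δ, hδ, hδD⟩ : ∃ δ : ℝ, 0 < δ ∧ ∀ t ∈ Set.Ioo 0 δ, v + t • n ∉ G.drawing := by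
    obtain ⟨δ, hδ, h⟩ := (mem_nhdsGT_iff_exists_Ioo_subset).1
      (htend.eventually (eventually_notMem_segment hE hvV))
    refine ⟨δ, hδ, fun t ht => ?_⟩
    rintro ⟨p, q, hpq, hx⟩
    refine (hφt t ht.1).not_ge ?_
    by_cases hp : p = v
    · subst hp
      exact hhalf.segment_subset (le_refl (φ p)) (hφN q hpq) hx
    by_cases hq : q = v
    · subst hq
      exact hhalf.segment_subset (hφN p (G.symm _ _ hpq)) (le_refl (φ q)) hx
    · exact absurd hx (h ht p q hpq hp hq)
  have hout : ∀ t ∈ Set.Ioo 0 δ, v + t • n ∈ G.outerRegion := by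
    refine fun t ht => ⟨hδD t ht, fun hbdd => ?_⟩
    obtain ⟨A, hA, B, hB, C, hC, hAB, hBC, hAC, hface⟩ := hF _ ⟨_, hδD t ht, rfl⟩ hbdd
    have hxF : v + t • n ∈ connectedComponentIn G.drawingᶜ (v + t • n) :=
      mem_connectedComponentIn (hδD t ht)
    have hray : ∀ s ∈ Set.Ioo 0 δ, v + s • n ∈ openTriangle A B C := by
      intro s hs
      rw [← hface]
      have hconn : IsPreconnected ((fun r : ℝ => v + r • n) '' Set.Ioo 0 δ) :=
        isPreconnected_Ioo.image _ (by fun_prop)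
      exact hconn.subset_connectedComponentIn ⟨t, ht, rfl⟩
        (by rintro _ ⟨r, hr, rfl⟩; exact hδD r hr) ⟨s, hs, rfl⟩
    have hvT : v ∈ convexHull ℝ {A, B, C} := by
      refine ((Set.toFinite _).isClosed_convexHull ℝ).mem_of_tendsto htend ?_
      filter_upwards [Ioo_mem_nhdsGT hδ] with s hs
      exact interior_subset (hray s hs)
    have hvi : v ∉ openTriangle A B C := by
      rw [← hface]
      exact fun h => connectedComponentIn_subset _ _ h hvD
    have hcorner : v = A ∨ v = B ∨ v = C := by
      have h := mem_segment_of_mem_convexHull_triple (hray t ht) hvT hvi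
      have := hE.2 A B v hAB hvV
      have := hE.2 B C v hBC hvV
      have := hE.2 A C v hAC hvV
      tauto
    have hsub : ({A, B, C} : Set (ℝ × ℝ)) ⊆ {y | φ v ≤ φ y} := by
      have hBA := G.symm _ _ hAB
      have hCA := G.symm _ _ hAC
      have hCB := G.symm _ _ hBC
      rintro y (rfl | rfl | rfl) <;> rcases hcorner with rfl | rfl | rfl <;>
        first | exact le_refl (φ _) | exact hφN _ ‹_›
    exact (hφt t ht.1).not_ge (convexHull_min hsub hhalf (interior_subset (hray t ht)))
  refine ⟨mem_closure_of_tendsto htend ?_, fun h => (interior_subset h).1 hvD⟩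
  filter_upwards [Ioo_mem_nhdsGT hδ] with t ht
  exact hout t ht

end PlaneGraph

/-- The features shared by `H₁` and `H₂`: the boundary cycle `0, 1, …, 11`, the hubs `0, 4, 8`
forming a triangle, and for every hub `c` the ear triangle `c + 1, c + 2, c + 3`, whose only
further neighbours are `c` and `c + 4`. -/
structure IsExceptionalShape (H : SimpleGraph (Fin 12)) : Prop where
  adj_succ : ∀ k, H.Adj k (k + 1)
  adj_hub : ∀ c ∈ ({0, 4, 8} : Finset (Fin 12)), H.Adj c (c + 4)
  adj_ear : ∀ c ∈ ({0, 4, 8} : Finset (Fin 12)), H.Adj (c + 1) (c + 3)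
  eq_of_adj_tip : ∀ c ∈ ({0, 4, 8} : Finset (Fin 12)), ∀ b, H.Adj (c + 2) b →
    b = c + 1 ∨ b = c + 3
  eq_of_adj_ear : ∀ c ∈ ({0, 4, 8} : Finset (Fin 12)), ∀ b, H.Adj (c + 1) b ∨ H.Adj (c + 3) b →
    b = c ∨ b = c + 1 ∨ b = c + 2 ∨ b = c + 3 ∨ b = c + 4

theorem isExceptionalShape_H1graph : IsExceptionalShape PlaneGraph.H1graph := by
  constructor <;> simp only [PlaneGraph.H1graph, SimpleGraph.fromRel_adj, PlaneGraph.exc1Edges] <;>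
    decide

theorem isExceptionalShape_H2graph : IsExceptionalShape PlaneGraph.H2graph := by
  constructor <;> simp only [PlaneGraph.H2graph, SimpleGraph.fromRel_adj, PlaneGraph.exc2Edges] <;>
    decide

theorem IsExceptionalShape.rotate {H : SimpleGraph (Fin 12)} (hH : IsExceptionalShape H)
    {r : Fin 12} (hr : r ∈ ({0, 4, 8} : Finset (Fin 12))) :
    IsExceptionalShape (H.comap (r + ·)) := by
  have hub : ∀ c ∈ ({0, 4, 8} : Finset (Fin 12)), r + c ∈ ({0, 4, 8} : Finset (Fin 12)) := by
    revert r; decide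
  constructor
  · intro k
    simpa [add_assoc] using hH.adj_succ (r + k)
  · intro c hc
    simpa [add_assoc] using hH.adj_hub _ (hub c hc)
  · intro c hc
    simpa [add_assoc] using hH.adj_ear _ (hub c hc)
  · intro c hc b hb
    simpa [add_assoc] using hH.eq_of_adj_tip _ (hub c hc) (r + b) (by simpa [add_assoc] using hb)
  · intro c hc b hb
    simpa [add_assoc] using hH.eq_of_adj_ear _ (hub c hc) (r + b) (by simpa [add_assoc] using hb)

theorem IsExceptionalShape.adj_seven_eight_nine {H : SimpleGraph (Fin 12)}
    (hH : IsExceptionalShape H) {k : Fin 12} (h1 : k ≠ 1) (h2 : k ≠ 2) (h3 : k ≠ 3) :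
    H.Adj k 7 ∨ H.Adj k 8 ∨ H.Adj k 9 := by
  have h57 : H.Adj 5 7 := hH.adj_ear 4 (by decide)
  have h911 : H.Adj 9 11 := hH.adj_ear 8 (by decide)
  have h48 : H.Adj 4 8 := hH.adj_hub 4 (by decide)
  have h80 : H.Adj 8 0 := hH.adj_hub 8 (by decide)
  have h67 := hH.adj_succ 6
  have h78 := hH.adj_succ 7
  have h89 := hH.adj_succ 8
  have h910 := hH.adj_succ 9
  fin_cases k <;> simp_all [SimpleGraph.adj_comm]

theorem IsExceptionalShape.adj_three_four_five {H : SimpleGraph (Fin 12)}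
    (hH : IsExceptionalShape H) {k : Fin 12} (h9 : k ≠ 9) (h10 : k ≠ 10) (h11 : k ≠ 11) :
    H.Adj k 3 ∨ H.Adj k 4 ∨ H.Adj k 5 := by
  have h57 : H.Adj 5 7 := hH.adj_ear 4 (by decide)
  have h13 : H.Adj 1 3 := hH.adj_ear 0 (by decide)
  have h48 : H.Adj 4 8 := hH.adj_hub 4 (by decide)
  have h04 : H.Adj 0 4 := hH.adj_hub 0 (by decide)
  have h23 := hH.adj_succ 2
  have h34 := hH.adj_succ 3
  have h45 := hH.adj_succ 4
  have h56 := hH.adj_succ 5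
  fin_cases k <;> simp_all [SimpleGraph.adj_comm]

theorem IsExceptionalShape.adj_of_mem_ear {H : SimpleGraph (Fin 12)}
    (hH : IsExceptionalShape H) {c : Fin 12} (hc : c ∈ ({0, 4, 8} : Finset (Fin 12)))
    {a b : Fin 12} (ha : a = c + 1 ∨ a = c + 2 ∨ a = c + 3)
    (hb : b = c + 1 ∨ b = c + 2 ∨ b = c + 3) (hab : a ≠ b) : H.Adj a b := by
  have h12 : H.Adj (c + 1) (c + 2) := by simpa [add_assoc] using hH.adj_succ (c + 1)
  have h23 : H.Adj (c + 2) (c + 3) := by simpa [add_assoc] using hH.adj_succ (c + 2)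
  have h13 := hH.adj_ear c hc
  rcases ha with rfl | rfl | rfl <;> rcases hb with rfl | rfl | rfl <;>
    first | exact absurd rfl hab | assumption | exact SimpleGraph.Adj.symm ‹_›

namespace PlaneGraph

variable {T : PlaneGraph} {H : SimpleGraph (Fin 12)} {p q : ℝ × ℝ} {w : Fin 12}
  {g : Fin 12 → ℝ × ℝ}

/-- A labelling `g` of the vertices of `T` other than `q` which identifies the contraction of the
edge `p q` of `T` with `H`, the contracted vertex `p` being labelled `w`. -/
structure IsContractionLabelling (T : PlaneGraph) (p q : ℝ × ℝ) (H : SimpleGraph (Fin 12))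
    (w : Fin 12) (g : Fin 12 → ℝ × ℝ) : Prop where
  injective : Function.Injective g
  ne : ∀ k, g k ≠ q
  mem : ∀ k, g k ∈ T.verts
  eq_or_exists : ∀ v ∈ T.verts, v = q ∨ ∃ k, g k = v
  map_contracted : g w = p
  adj_contracted : T.Adj p q
  adj_iff : ∀ a b, a ≠ w → b ≠ w → (T.Adj (g a) (g b) ↔ H.Adj a b)
  adj_contracted_iff : ∀ b, b ≠ w → (T.Adj p (g b) ∨ T.Adj q (g b) ↔ H.Adj w b)

theorem exists_isContractionLabelling (hpq : T.Adj p q)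
    (h : (T.contractEdge p q).IsIsoToSG H) :
    ∃ w g, T.IsContractionLabelling p q H w g := by
  obtain ⟨f, hf, hadj⟩ := h
  have hp : p ∈ T.verts.erase q :=
    Finset.mem_erase.2 ⟨fun e => T.loopless q (by rwa [e] at hpq), (T.mem_of_adj p q hpq).1⟩
  choose g hgV hg using fun k => hf.surjOn (Set.mem_univ k)
  have hg_f : ∀ v ∈ T.verts.erase q, g (f v) = v := fun v hv => hf.injOn (hgV _) hv (hg _)
  have hinj : Function.Injective g := fun a b hab => by rw [← hg a, hab, hg]
  have hgE : ∀ k, g k ∈ T.verts.erase q := hgV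
  have hne : ∀ k, g k ≠ q := fun k => (Finset.mem_erase.1 (hgE k)).1
  have hgp : ∀ b, b ≠ f p → g b ≠ p := fun b hb e => hb (by rw [← e, hg])
  refine ⟨f p, g, hinj, hne, fun k => (Finset.mem_erase.1 (hgE k)).2, ?_, hg_f p hp, hpq, ?_, ?_⟩
  · intro v hv
    by_cases hvq : v = q
    · exact Or.inl hvq
    · exact Or.inr ⟨f v, hg_f v (Finset.mem_erase.2 ⟨hvq, hv⟩)⟩
  · intro a b ha hb
    have := hadj (g a) (hgV a) (g b) (hgV b)
    rw [hg, hg] at this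
    rw [← this]
    refine ⟨fun hab => ⟨fun e => T.loopless _ (e ▸ hab), hgE a, hgE b, Or.inl hab⟩, ?_⟩
    rintro ⟨-, -, -, hab | ⟨e, -⟩ | ⟨e, -⟩⟩
    · exact hab
    · exact absurd e (hgp a ha)
    · exact absurd e (hgp b hb)
  · intro b hb
    have := hadj p hp (g b) (hgV b)
    rw [hg] at this
    rw [← this]
    constructor
    · rintro (hab | hab)
      · exact ⟨(hgp b hb).symm, hp, hgE b, Or.inl hab⟩
      · exact ⟨(hgp b hb).symm, hp, hgE b, Or.inr (Or.inl ⟨rfl, hab⟩)⟩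
    · rintro ⟨-, -, -, hab | ⟨-, hab⟩ | ⟨e, -⟩⟩
      · exact Or.inl hab
      · exact Or.inr hab
      · exact absurd e (hgp b hb)

theorem IsContractionLabelling.rotate {r : Fin 12}
    (hg : T.IsContractionLabelling p q H (r + w) g) :
    T.IsContractionLabelling p q (H.comap (r + ·)) w fun k => g (r + k) where
  injective := hg.injective.comp (add_right_injective r)
  ne k := hg.ne _
  mem k := hg.mem _
  eq_or_exists v hv := by
    refine (hg.eq_or_exists v hv).imp id ?_
    rintro ⟨k, rfl⟩
    exact ⟨k - r, by simp⟩
  map_contracted := hg.map_contracted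
  adj_contracted := hg.adj_contracted
  adj_iff a b ha hb := hg.adj_iff _ _ (by simpa using ha) (by simpa using hb)
  adj_contracted_iff b hb := hg.adj_contracted_iff _ (by simpa using hb)

namespace IsContractionLabelling

/-- If `S` dominates every vertex outside the closed neighbourhood of the contracted vertex, then
`S` together with both ends of the contracted edge is a total dominating set. -/
theorem isTDS_insert_image (hg : T.IsContractionLabelling p q H w g) {S : Finset (Fin 12)}
    (hwS : w ∈ S) (hS : ∀ k, k ≠ w → H.Adj w k ∨ ∃ s ∈ S, s ≠ w ∧ H.Adj k s) :
    T.IsTDS (insert q (S.image g)) := by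
  have hpD : p ∈ insert q (S.image g) :=
    Finset.mem_insert_of_mem (Finset.mem_image.2 ⟨w, hwS, hg.map_contracted⟩)
  have hqD : q ∈ insert q (S.image g) := Finset.mem_insert_self _ _
  refine ⟨?_, fun v hv => ?_⟩
  · intro v hv
    rcases Finset.mem_insert.1 hv with rfl | hv
    · exact (T.mem_of_adj _ _ hg.adj_contracted).2
    · obtain ⟨k, -, rfl⟩ := Finset.mem_image.1 hv
      exact hg.mem k
  · rcases hg.eq_or_exists v hv with rfl | ⟨k, rfl⟩
    · exact ⟨p, hpD, T.symm _ _ hg.adj_contracted⟩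
    by_cases hk : k = w
    · exact ⟨q, hqD, by rw [hk, hg.map_contracted]; exact hg.adj_contracted⟩
    rcases hS k hk with h | ⟨s, hs, hsw, h⟩
    · rcases (hg.adj_contracted_iff k hk).2 h with h | h
      · exact ⟨p, hpD, T.symm _ _ h⟩
      · exact ⟨q, hqD, T.symm _ _ h⟩
    · exact ⟨g s, Finset.mem_insert_of_mem (Finset.mem_image_of_mem g hs),
        (hg.adj_iff k s hk hsw).2 h⟩

/-- If `p` is adjacent to the vertex labelled `a`, and `S` contains `a` and dominates every vertex
other than `a` and the contracted one, then `S` together with `p` is a total dominating set. -/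
theorem isTDS_image (hg : T.IsContractionLabelling p q H w g) {S : Finset (Fin 12)} {a : Fin 12}
    (hwS : w ∈ S) (haS : a ∈ S) (ha : T.Adj p (g a))
    (hS : ∀ k, k ≠ w → k ≠ a → ∃ s ∈ S, s ≠ w ∧ H.Adj k s) :
    T.IsTDS (S.image g) := by
  have hpD : p ∈ S.image g := Finset.mem_image.2 ⟨w, hwS, hg.map_contracted⟩
  refine ⟨?_, fun v hv => ?_⟩
  · intro v hv
    obtain ⟨k, -, rfl⟩ := Finset.mem_image.1 hv
    exact hg.mem k
  · rcases hg.eq_or_exists v hv with rfl | ⟨k, rfl⟩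
    · exact ⟨p, hpD, T.symm _ _ hg.adj_contracted⟩
    by_cases hk : k = w
    · exact ⟨g a, Finset.mem_image_of_mem g haS, by rw [hk, hg.map_contracted]; exact ha⟩
    by_cases hka : k = a
    · exact ⟨p, hpD, hka ▸ T.symm _ _ ha⟩
    obtain ⟨s, hs, hsw, h⟩ := hS k hk hka
    exact ⟨g s, Finset.mem_image_of_mem g hs, (hg.adj_iff k s hk hsw).2 h⟩

theorem exists_isTDS_of_ear (hH : IsExceptionalShape H) (hg : T.IsContractionLabelling p q H w g)
    (hw : w = 1 ∨ w = 2 ∨ w = 3) :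
    ∃ D : Finset (ℝ × ℝ), T.IsTDS D ∧ D.card = 5 ∧ p ∈ D := by
  refine ⟨insert q (({w, 7, 8, 9} : Finset (Fin 12)).image g), hg.isTDS_insert_image (by simp) ?_,
    ?_, ?_⟩
  · intro k hk
    by_cases hear : k = 1 ∨ k = 2 ∨ k = 3
    · exact Or.inl (hH.adj_of_mem_ear (c := 0) (by decide) (by simpa using hw) (by simpa using hear)
        hk.symm)
    · push Not at hear
      have hw' : 7 ≠ w ∧ 8 ≠ w ∧ 9 ≠ w := by rcases hw with rfl | rfl | rfl <;> decide
      have := hH.adj_seven_eight_nine hear.1 hear.2.1 hear.2.2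
      right
      simp only [Finset.mem_insert, Finset.mem_singleton]
      grind
  · rw [Finset.card_insert_of_notMem, Finset.card_image_of_injective _ hg.injective]
    · rcases hw with rfl | rfl | rfl <;> rfl
    · simpa using ⟨(hg.ne w).symm, (hg.ne 7).symm, (hg.ne 8).symm, (hg.ne 9).symm⟩
  · simp [← hg.map_contracted]

theorem exists_isTDS_of_adj_first_ear (hH : IsExceptionalShape H)
    (hg : T.IsContractionLabelling p q H 0 g) {a : Fin 12} (ha : a = 1 ∨ a = 2 ∨ a = 3)
    (hpa : T.Adj p (g a)) :
    ∃ D : Finset (ℝ × ℝ), T.IsTDS D ∧ D.card = 5 ∧ p ∈ D := by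
  refine ⟨({0, a, 7, 8, 9} : Finset (Fin 12)).image g,
    hg.isTDS_image (by simp) (by simp) hpa ?_, ?_, ?_⟩
  · intro k hk0 hka
    simp only [Finset.mem_insert, Finset.mem_singleton]
    by_cases hear : k = 1 ∨ k = 2 ∨ k = 3
    · have := hH.adj_of_mem_ear (c := 0) (by decide) (by simpa using hear) (by simpa using ha) hka
      have ha0 : a ≠ 0 := by rcases ha with rfl | rfl | rfl <;> decide
      exact ⟨a, by simp, ha0, this⟩
    · push Not at hear
      rcases hH.adj_seven_eight_nine hear.1 hear.2.1 hear.2.2 with h | h | h <;>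
        exact ⟨_, by simp, by decide, h⟩
  · rw [Finset.card_image_of_injective _ hg.injective]
    rcases ha with rfl | rfl | rfl <;> rfl
  · exact Finset.mem_image.2 ⟨0, by simp, hg.map_contracted⟩

theorem exists_isTDS_of_adj_last_ear (hH : IsExceptionalShape H)
    (hg : T.IsContractionLabelling p q H 0 g) {a : Fin 12} (ha : a = 9 ∨ a = 10 ∨ a = 11)
    (hpa : T.Adj p (g a)) :
    ∃ D : Finset (ℝ × ℝ), T.IsTDS D ∧ D.card = 5 ∧ p ∈ D := by
  refine ⟨({0, a, 3, 4, 5} : Finset (Fin 12)).image g,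
    hg.isTDS_image (by simp) (by simp) hpa ?_, ?_, ?_⟩
  · intro k hk0 hka
    simp only [Finset.mem_insert, Finset.mem_singleton]
    by_cases hear : k = 9 ∨ k = 10 ∨ k = 11
    · have := hH.adj_of_mem_ear (c := 8) (by decide) (by simpa using hear) (by simpa using ha) hka
      have ha0 : a ≠ 0 := by rcases ha with rfl | rfl | rfl <;> decide
      exact ⟨a, by simp, ha0, this⟩
    · push Not at hear
      rcases hH.adj_three_four_five hear.1 hear.2.1 hear.2.2 with h | h | h <;>
        exact ⟨_, by simp, by decide, h⟩
  · rw [Finset.card_image_of_injective _ hg.injective]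
    rcases ha with rfl | rfl | rfl <;> rfl
  · exact Finset.mem_image.2 ⟨0, by simp, hg.map_contracted⟩

end IsContractionLabelling

end PlaneGraph

theorem ZMod.eq_of_natCast_eq_zero {h m : ℕ} (hm : (m : ZMod h) = 0) (hpos : 0 < m)
    (hlt : m < 2 * h) : h = m := by
  obtain ⟨c, rfl⟩ := (ZMod.natCast_eq_zero_iff m h).1 hm
  have : c < 2 := by nlinarith
  have : c ≠ 0 := by rintro rfl; simp at hpos
  have : c = 1 := by omega
  simp [this]

/-- If a cycle `u` runs through a vertex `u j` whose neighbours are among `a, b`, the further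
neighbours of `a, b` are among `x, y`, and `u` contains some other vertex, then `u` passes from
`{a, b}` to both `x` and `y`. -/
theorem exists_cycle_step {V : Type*} {Adj : V → V → Prop} (hsymm : ∀ s t, Adj s t → Adj t s)
    {h : ℕ} (h3 : 3 ≤ h) {u : ZMod h → V} (hinj : Function.Injective u)
    (hadj : ∀ i, Adj (u i) (u (i + 1))) {i j : ZMod h} {a b x y : V}
    (hj : ∀ t, Adj (u j) t → t = a ∨ t = b)
    (hab : ∀ s t, s = a ∨ s = b → Adj s t → t = u j ∨ t = a ∨ t = b ∨ t = x ∨ t = y)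
    (hij : u i ≠ u j) (hia : u i ≠ a) (hib : u i ≠ b) (hix : u i ≠ x) (hiy : u i ≠ y)
    {z : V} (hz : z = x ∨ z = y) :
    ∃ k, u k = z ∧ (u (k + 1) = a ∨ u (k + 1) = b ∨ u (k - 1) = a ∨ u (k - 1) = b) := by
  have hadj' : ∀ i, Adj (u i) (u (i - 1)) := fun i => by
    simpa using hsymm _ _ (hadj (i - 1))
  have h1 : (1 : ZMod h) ≠ 0 := fun e => by
    have := ZMod.eq_of_natCast_eq_zero (h := h) (m := 1) (by simpa using e) one_pos (by omega)
    omega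
  have h2 : (2 : ZMod h) ≠ 0 := fun e => by
    have := ZMod.eq_of_natCast_eq_zero (h := h) (m := 2) (by simpa using e) two_pos (by omega)
    omega
  have hp := hj _ (hadj j)
  have hm := hj _ (hadj' j)
  have hpm : u (j + 1) ≠ u (j - 1) := fun e => h2 (by linear_combination hinj e)
  have h3' : (3 : ZMod h) ≠ 0 := fun e => by
    obtain rfl := ZMod.eq_of_natCast_eq_zero (h := h) (m := 3) (by simpa using e) (by omega)
      (by omega)
    have cover : ∀ i j : ZMod 3, i = j ∨ i = j + 1 ∨ i = j - 1 := by decide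
    rcases cover i j with rfl | rfl | rfl
    exacts [hij rfl, hp.elim hia hib, hm.elim hia hib]
  have hpp : u (j + 2) = x ∨ u (j + 2) = y := by
    have e : j + 1 + 1 = j + 2 := by ring
    have hne0 : u (j + 2) ≠ u j := fun e => h2 (by linear_combination hinj e)
    have hne1 : u (j + 2) ≠ u (j + 1) := fun e => h1 (by linear_combination hinj e)
    have hne2 : u (j + 2) ≠ u (j - 1) := fun e => h3' (by linear_combination hinj e)
    have := hab _ _ hp (hadj (j + 1))
    rw [e] at this
    grind
  have hmm : u (j - 2) = x ∨ u (j - 2) = y := by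
    have e : j - 1 - 1 = j - 2 := by ring
    have hne0 : u (j - 2) ≠ u j := fun e => h2 (by linear_combination -hinj e)
    have hne1 : u (j - 2) ≠ u (j - 1) := fun e => h1 (by linear_combination -hinj e)
    have hne2 : u (j - 2) ≠ u (j + 1) := fun e => h3' (by linear_combination -hinj e)
    have := hab _ _ hm (hadj' (j - 1))
    rw [e] at this
    grind
  have hne : u (j + 2) ≠ u (j - 2) := fun e => by
    obtain rfl := ZMod.eq_of_natCast_eq_zero (h := h) (m := 4)
      (by push_cast; linear_combination hinj e) (by omega) (by omega)
    have cover : ∀ i j : ZMod 4, i = j ∨ i = j + 1 ∨ i = j - 1 ∨ i = j + 2 := by decide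
    rcases cover i j with rfl | rfl | rfl | rfl
    exacts [hij rfl, hp.elim hia hib, hm.elim hia hib, hpp.elim hix hiy]
  have hz' : z = u (j + 2) ∨ z = u (j - 2) := by grind
  rcases hz' with rfl | rfl
  · refine ⟨j + 2, rfl, ?_⟩
    rw [show j + 2 - 1 = j + 1 by ring]
    exact Or.inr (Or.inr hp)
  · refine ⟨j - 2, rfl, ?_⟩
    rw [show j - 2 + 1 = j - 1 by ring]
    exact hm.elim Or.inl fun hb => Or.inr (Or.inl hb)

namespace PlaneGraph

variable {T : PlaneGraph} {H : SimpleGraph (Fin 12)} {q : ℝ × ℝ} {g : Fin 12 → ℝ × ℝ}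

/-- The boundary cycle passes through the tips of the three ears, hence uses both cycle edges at
each hub to enter an ear; so it misses a vertex that is adjacent only to hubs. -/
theorem IsBoundaryCycle.false_of_adj_hubs (hH : IsExceptionalShape H) (hE : T.IsEmbedded)
    (hF : T.InnerFacesTriangles) {h : ℕ} {u : ZMod h → ℝ × ℝ} (hu : T.IsBoundaryCycle u)
    {i : ZMod h} (hinj : Function.Injective g) (hi : ∀ k, g k ≠ u i)
    (hV : ∀ v ∈ T.verts, v = u i ∨ ∃ k, g k = v)
    (hadj : ∀ a b, T.Adj (g a) (g b) → H.Adj a b)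
    (htip : ∀ c ∈ ({0, 4, 8} : Finset (Fin 12)), T.Adj (g (c + 2)) (g (c + 1)))
    (hhub : ∀ k, T.Adj (u i) (g k) → k ∈ ({0, 4, 8} : Finset (Fin 12))) : False := by
  obtain ⟨h3, huinj, huV, huadj, -, hufr⟩ := hu
  have hni : ∀ k, k ∉ ({0, 4, 8} : Finset (Fin 12)) → ∀ t, T.Adj (g k) t →
      ∃ b, g b = t ∧ H.Adj k b := by
    intro k hk t ht
    rcases hV t (T.mem_of_adj _ _ ht).2 with rfl | ⟨b, rfl⟩
    · exact absurd (hhub k (T.symm _ _ ht)) hk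
    · exact ⟨b, rfl, hadj _ _ ht⟩
  have hoff : ∀ c ∈ ({0, 4, 8} : Finset (Fin 12)), c + 1 ∉ ({0, 4, 8} : Finset (Fin 12)) ∧
      c + 2 ∉ ({0, 4, 8} : Finset (Fin 12)) ∧ c + 3 ∉ ({0, 4, 8} : Finset (Fin 12)) := by decide
  have step : ∀ c ∈ ({0, 4, 8} : Finset (Fin 12)), ∀ z, z = c ∨ z = c + 4 → ∀ k, u k = g z →
      u (k + 1) = g (c + 1) ∨ u (k + 1) = g (c + 3) ∨ u (k - 1) = g (c + 1) ∨
        u (k - 1) = g (c + 3) := by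
    intro c hc z hz k hk
    obtain ⟨hc1, hc2, hc3⟩ := hoff c hc
    have htipN : ∀ t, T.Adj (g (c + 2)) t → t = g (c + 1) ∨ t = g (c + 3) := by
      intro t ht
      obtain ⟨b, rfl, hb⟩ := hni _ hc2 t ht
      rcases hH.eq_of_adj_tip c hc b hb with rfl | rfl <;> simp
    obtain ⟨j, hj⟩ := hufr _ (T.mem_of_adj _ _ (htip c hc)).1
      (mem_frontier_outerRegion hE hF (htip c hc) htipN)
    have hearN : ∀ s t, s = g (c + 1) ∨ s = g (c + 3) → T.Adj s t →
        t = u j ∨ t = g (c + 1) ∨ t = g (c + 3) ∨ t = g c ∨ t = g (c + 4) := by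
      intro s t hs ht
      have : ∃ b, g b = t ∧ (H.Adj (c + 1) b ∨ H.Adj (c + 3) b) := by
        rcases hs with rfl | rfl
        · obtain ⟨b, hb, hb'⟩ := hni _ hc1 t ht
          exact ⟨b, hb, Or.inl hb'⟩
        · obtain ⟨b, hb, hb'⟩ := hni _ hc3 t ht
          exact ⟨b, hb, Or.inr hb'⟩
      obtain ⟨b, rfl, hb⟩ := this
      rw [hj]
      rcases hH.eq_of_adj_ear c hc b hb with rfl | rfl | rfl | rfl | rfl <;> simp
    obtain ⟨k', hk', hstep⟩ := exists_cycle_step T.symm h3 huinj huadj (i := i) (j := j)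
      (by rwa [hj]) hearN (by rw [hj]; exact (hi _).symm) (hi _).symm (hi _).symm (hi _).symm
      (hi _).symm (z := g z) (by rcases hz with rfl | rfl <;> simp)
    obtain rfl : k' = k := huinj (hk'.trans hk.symm)
    exact hstep
  have hui : u (i + 1) ≠ u i := fun e => T.loopless (u i) (by simpa [e] using huadj i)
  obtain ⟨z, hz⟩ := (hV _ (huV (i + 1))).resolve_left hui
  have hzhub : z ∈ ({0, 4, 8} : Finset (Fin 12)) := hhub z (hz ▸ huadj i)
  have hz4 : ∀ z ∈ ({0, 4, 8} : Finset (Fin 12)),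
      z - 4 ∈ ({0, 4, 8} : Finset (Fin 12)) ∧ z = z - 4 + 4 ∧
      z + 1 ≠ z - 4 + 1 ∧ z + 1 ≠ z - 4 + 3 ∧ z + 3 ≠ z - 4 + 1 ∧ z + 3 ≠ z - 4 + 3 := by decide
  obtain ⟨hc, hzc, hne⟩ := hz4 z hzhub
  have s1 := step z hzhub z (Or.inl rfl) (i + 1) hz.symm
  have s2 := step (z - 4) hc z (Or.inr hzc) (i + 1) hz.symm
  simp only [add_sub_cancel_right, (hi _).symm, or_false] at s1 s2
  rcases s1 with s1 | s1 <;> rcases s2 with s2 | s2 <;>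
    have := hinj (s1.symm.trans s2) <;> tauto

theorem exists_isTDS_of_isContractionLabelling_zero (hH : IsExceptionalShape H)
    (hE : T.IsEmbedded) (hF : T.InnerFacesTriangles) {h : ℕ} {u : ZMod h → ℝ × ℝ}
    (hu : T.IsBoundaryCycle u) {i : ZMod h} (hg : T.IsContractionLabelling (u i) q H 0 g) :
    ∃ D : Finset (ℝ × ℝ), T.IsTDS D ∧ D.card = 5 ∧ u i ∈ D := by
  by_contra hD
  have hupd : ∀ k, k ≠ 0 → Function.update g 0 q k = g k :=
    fun k hk => Function.update_of_ne hk _ _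
  have hupd0 : Function.update g 0 q 0 = q := Function.update_self _ _ _
  refine hu.false_of_adj_hubs (g := Function.update g 0 q) (i := i) hH hE hF ?_ ?_ ?_ ?_ ?_ ?_
  · intro a b hab
    by_cases ha : a = 0 <;> by_cases hb : b = 0
    · rw [ha, hb]
    · rw [ha, hupd0, hupd b hb] at hab
      exact absurd hab.symm (hg.ne b)
    · rw [hb, hupd0, hupd a ha] at hab
      exact absurd hab (hg.ne a)
    · rw [hupd a ha, hupd b hb] at hab
      exact hg.injective hab
  · intro k
    by_cases hk : k = 0
    · subst hk
      rw [hupd0]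
      rintro rfl
      exact T.loopless _ hg.adj_contracted
    · rw [hupd k hk, ← hg.map_contracted]
      exact hg.injective.ne hk
  · intro v hv
    rcases hg.eq_or_exists v hv with rfl | ⟨k, rfl⟩
    · exact Or.inr ⟨0, hupd0⟩
    by_cases hk : k = 0
    · exact Or.inl (by rw [hk, hg.map_contracted])
    · exact Or.inr ⟨k, hupd k hk⟩
  · intro a b hab
    by_cases ha : a = 0 <;> by_cases hb : b = 0
    · subst ha hb
      exact absurd hab (T.loopless _)
    · subst ha
      rw [hupd0, hupd b hb] at hab
      exact (hg.adj_contracted_iff b hb).1 (Or.inr hab)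
    · subst hb
      rw [hupd0, hupd a ha] at hab
      exact ((hg.adj_contracted_iff a ha).1 (Or.inr (T.symm _ _ hab))).symm
    · rw [hupd a ha, hupd b hb] at hab
      exact (hg.adj_iff a b ha hb).1 hab
  · intro c hc
    have hne : c + 2 ≠ 0 ∧ c + 1 ≠ 0 := by revert c; decide
    rw [hupd _ hne.1, hupd _ hne.2, hg.adj_iff _ _ hne.1 hne.2]
    simpa [add_assoc] using (hH.adj_succ (c + 1)).symm
  · intro k hk
    by_cases hk0 : k = 0
    · simp [hk0]
    rw [hupd k hk0] at hk
    have hHk := (hg.adj_contracted_iff k hk0).1 (Or.inl hk)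
    have hfirst : ¬(k = 1 ∨ k = 2 ∨ k = 3) :=
      fun hk' => hD (hg.exists_isTDS_of_adj_first_ear hH hk' hk)
    have hlast : ¬(k = 9 ∨ k = 10 ∨ k = 11) :=
      fun hk' => hD (hg.exists_isTDS_of_adj_last_ear hH hk' hk)
    have h5 : k ≠ 5 := by
      rintro rfl
      exact absurd (hH.eq_of_adj_ear 4 (by decide) 0 (Or.inl hHk.symm)) (by decide)
    have h6 : k ≠ 6 := by
      rintro rfl
      exact absurd (hH.eq_of_adj_tip 4 (by decide) 0 hHk.symm) (by decide)
    have h7 : k ≠ 7 := by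
      rintro rfl
      exact absurd (hH.eq_of_adj_ear 4 (by decide) 0 (Or.inr hHk.symm)) (by decide)
    clear hHk hk
    revert k
    decide

theorem exists_isTDS_of_isIsoToSG (hH : IsExceptionalShape H)
    (hE : T.IsEmbedded) (hF : T.InnerFacesTriangles) {h : ℕ} {u : ZMod h → ℝ × ℝ}
    (hu : T.IsBoundaryCycle u) {i : ZMod h} (hq : T.Adj (u i) q)
    (hiso : (T.contractEdge (u i) q).IsIsoToSG H) :
    ∃ D : Finset (ℝ × ℝ), T.IsTDS D ∧ D.card = 5 ∧ u i ∈ D := by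
  obtain ⟨w, g, hg⟩ := exists_isContractionLabelling hq hiso
  obtain ⟨r, hr, w, hw, rfl⟩ : ∃ r ∈ ({0, 4, 8} : Finset (Fin 12)), ∃ w' : Fin 12,
      (w' = 0 ∨ w' = 1 ∨ w' = 2 ∨ w' = 3) ∧ r + w' = w := by
    clear hg
    revert w
    decide
  have hH' := hH.rotate hr
  rcases hw with rfl | hw
  · exact exists_isTDS_of_isContractionLabelling_zero hH' hE hF hu hg.rotate
  · exact hg.rotate.exists_isTDS_of_ear hH' hw

end PlaneGraph

/-- Let `T` be a near-triangulation with boundary cycle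
`C = (u_1, …, u_h, u_1)` and let `u_i` be a boundary vertex.  If there exists an edge `e`
incident with `u_i` such that the contracted graph `T/e` is isomorphic to `H₁` or `H₂`, then
`T` has a total dominating set of size 5 containing `u_i`. -/
theorem TDS_of_contract_exceptional (T : PlaneGraph) (h : ℕ) (u : ZMod h → ℝ × ℝ)
    (i : ZMod h) (hT : T.IsNearTriangulation) (hu : T.IsBoundaryCycle u)
    (hexc : ∃ q : ℝ × ℝ, T.Adj (u i) q ∧ (T.contractEdge (u i) q).IsExceptional) :
    ∃ D : Finset (ℝ × ℝ), T.IsTDS D ∧ D.card = 5 ∧ u i ∈ D := by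
  obtain ⟨q, hq, hiso | hiso⟩ := hexc
  · exact PlaneGraph.exists_isTDS_of_isIsoToSG isExceptionalShape_H1graph hT.1 hT.2.2 hu hq hiso
  · exact PlaneGraph.exists_isTDS_of_isIsoToSG isExceptionalShape_H2graph hT.1 hT.2.2 hu hq hiso
end
end

section
/- Let T be a near-triangulation of order n ≥ 5 with boundary cycle C = (u_1, ..., u_h, u_1). Suppose that for some boundary vertex u_i there is a contractible edge e = (u_i, v_i) of T such that T/e has a total dominating set of size s. Then T has a set of vertices D satisfying one of the following: (i) D is a total dominating set of T of size s + 1 containing both u_i and v_i; or (ii) D has size s, contains neither u_i nor v_i, and dominates all vertices of T except possibly one of u_i or v_i. -/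
/-!
Common definitions.

A *plane graph* is a finite graph whose vertices are points of the plane `ℝ × ℝ` and whose
edges are drawn as straight-line segments between their endpoints (by Fáry's theorem every
planar graph admits such a drawing).  A *near-triangulation* is a plane graph that is properly
embedded, biconnected, and all of whose bounded faces are triangles (the faces are the
connected components of the complement of the drawing).  The boundary cycle lists, cyclically,
the vertices on the outer (unbounded) face.
-/

open scoped Classical

noncomputable section

/-- Lifting a total dominating set of a contraction `G/(p, q)` back to `G`. -/
theorem PlaneGraph.IsTDS.lift_contractEdge {G : PlaneGraph} {p q : ℝ × ℝ} (hpq : G.Adj p q)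
    {D : Finset (ℝ × ℝ)} (hD : (G.contractEdge p q).IsTDS D) :
    (p ∈ D ∧ q ∉ D ∧ G.IsTDS (insert q D)) ∨
    (D ⊆ G.verts ∧ p ∉ D ∧ q ∉ D ∧
      ((∀ w ∈ G.verts, w ≠ p → ∃ d ∈ D, G.Adj w d) ∨
       (∀ w ∈ G.verts, w ≠ q → ∃ d ∈ D, G.Adj w d))) := by
  obtain ⟨hsub, hdom⟩ := hD
  obtain ⟨hp, hq⟩ := G.mem_of_adj p q hpq
  have hqD : q ∉ D := fun hmem => Finset.notMem_erase q G.verts (hsub hmem)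
  have hDG : D ⊆ G.verts := hsub.trans (Finset.erase_subset q G.verts)
  have hne : p ≠ q := by
    rintro rfl
    exact G.loopless p hpq
  by_cases hpD : p ∈ D
  · refine Or.inl ⟨hpD, hqD, Finset.insert_subset hq hDG, fun w hw => ?_⟩
    by_cases hwq : w = q
    · subst hwq
      exact ⟨p, Finset.mem_insert_of_mem hpD, G.symm _ _ hpq⟩
    by_cases hwp : w = p
    · subst hwp
      exact ⟨q, Finset.mem_insert_self q D, hpq⟩
    obtain ⟨d, hd, -, -, -, hadj | ⟨hwp', -⟩ | ⟨-, hadj⟩⟩ :=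
      hdom w (Finset.mem_erase.mpr ⟨hwq, hw⟩)
    · exact ⟨d, Finset.mem_insert_of_mem hd, hadj⟩
    · exact absurd hwp' hwp
    · exact ⟨q, Finset.mem_insert_self q D, G.symm _ _ hadj⟩
  · have key : ∀ w ∈ G.verts, w ≠ p → w ≠ q → ∃ d ∈ D, G.Adj w d := by
      intro w hw hwp hwq
      obtain ⟨d, hd, -, -, -, hadj | ⟨hwp', -⟩ | ⟨rfl, -⟩⟩ :=
        hdom w (Finset.mem_erase.mpr ⟨hwq, hw⟩)
      · exact ⟨d, hd, hadj⟩
      · exact absurd hwp' hwp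
      · exact absurd hd hpD
    refine Or.inr ⟨hDG, hpD, hqD, ?_⟩
    obtain ⟨d, hd, -, -, -, hadj | ⟨-, hadj⟩ | ⟨rfl, -⟩⟩ :=
      hdom p (Finset.mem_erase.mpr ⟨hne, hp⟩)
    · refine Or.inr fun w hw hwq => ?_
      by_cases hwp : w = p
      · exact ⟨d, hd, hwp ▸ hadj⟩
      · exact key w hw hwp hwq
    · refine Or.inl fun w hw hwp => ?_
      by_cases hwq : w = q
      · exact ⟨d, hd, hwq ▸ hadj⟩
      · exact key w hw hwp hwq
    · exact absurd hd hpD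

/-- Let `T` be a near-triangulation of order `n ≥ 5` with boundary cycle
`C = (u_1, …, u_h, u_1)`.  Suppose that for some boundary vertex `u_i` there is a contractible
edge `e = (u_i, v_i)` of `T` such that `T/e` has a total dominating set of size `s`.  Then `T`
has a set of vertices `D` such that either (i) `D` is a total dominating set of `T` of size
`s + 1` containing both `u_i` and `v_i`, or (ii) `D` has size `s`, contains neither `u_i` nor
`v_i`, and dominates all vertices of `T` except possibly one of `u_i` or `v_i`. -/
theorem TDS_lift_of_contract (T : PlaneGraph) (h : ℕ) (u : ZMod h → ℝ × ℝ)
    (i : ZMod h) (v : ℝ × ℝ) (s : ℕ)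
    (hT : T.IsNearTriangulation) (hu : T.IsBoundaryCycle u) (hn : 5 ≤ T.verts.card)
    (hc : T.IsContractible (u i) v)
    (hTDS : ∃ D : Finset (ℝ × ℝ), (T.contractEdge (u i) v).IsTDS D ∧ D.card = s) :
    (∃ D : Finset (ℝ × ℝ), T.IsTDS D ∧ D.card = s + 1 ∧ u i ∈ D ∧ v ∈ D) ∨
    (∃ D : Finset (ℝ × ℝ), D ⊆ T.verts ∧ D.card = s ∧ u i ∉ D ∧ v ∉ D ∧
      ((∀ w ∈ T.verts, w ≠ u i → ∃ d ∈ D, T.Adj w d) ∨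
       (∀ w ∈ T.verts, w ≠ v → ∃ d ∈ D, T.Adj w d))) := by
  obtain ⟨D, hD, rfl⟩ := hTDS
  obtain ⟨hpD, hvD, hins⟩ | ⟨hsub, hpD, hvD, hdom⟩ := hD.lift_contractEdge hc.1
  · exact Or.inl ⟨insert v D, hins, Finset.card_insert_of_notMem hvD,
      Finset.mem_insert_of_mem hpD, Finset.mem_insert_self v D⟩
  · exact Or.inr ⟨D, hsub, rfl, hpD, hvD, hdom⟩
end
end
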